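/- Let m ≥ 2 and let k ∈ {1,…,m−1} satisfy λ_k > 1/2. Define g_k : (0,1) → ℂ by g_k(u) := (1/Γ(1+ω^k))·(u^{ω^k} + ω^k (1−u)^{ω^k} − 1). Then there exist a probability space carrying a cyclic urn process (R_n)_{n≥0} with m types started with one ball of type 0, complex random variables Ξ_k, Ξ_k^{(0)}, Ξ_k^{(1)} and a random variable U uniformly distributed on [0,1], all on this space, such that: M_{k,n} → Ξ_k almost surely as n → ∞; U, Ξ_k^{(0)}, Ξ_k^{(1)} are independent; Ξ_k^{(0)} and Ξ_k^{(1)} each have the same distribution as Ξ_k; and almost surely Ξ_k = U^{ω^k}·Ξ_k^{(0)} + ω^k·(1−U)^{ω^k}·Ξ_k^{(1)} + g_k(U). -/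

import Mathlib

open MeasureTheory ProbabilityTheory Filter Complex Finset Topology

noncomputable section

/-- `ω = exp(2πi/m)`, the `m`-th elementary root of unity. -/
def cw (m : ℕ) : ℂ := Complex.exp (2 * Real.pi * Complex.I / m)

/-- `λ_k = cos(2πk/m)`. -/
def lam (m k : ℕ) : ℝ := Real.cos (2 * Real.pi * k / m)

/-- `μ_k = sin(2πk/m)`. -/
def muim (m k : ℕ) : ℝ := Real.sin (2 * Real.pi * k / m)

/-- the eigenvector `v_k = (1/m)(1, ω^{-k}, …, ω^{-(m-1)k})`. -/
def vvec (m k : ℕ) : Fin m → ℂ :=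
  fun t => (m : ℂ)⁻¹ * cw m ^ (-((k * (t : ℕ) : ℕ) : ℤ))

/-- the dual coefficient `u_k(w) = ∑_t ω^{kt} w_t`. -/
def ucoef (m k : ℕ) (w : Fin m → ℝ) : ℂ :=
  ∑ t : Fin m, cw m ^ (k * (t : ℕ)) * (w t : ℂ)

/-- the replacement matrix `A` of the cyclic urn. -/
def repA (m : ℕ) : Matrix (Fin m) (Fin m) ℝ :=
  Matrix.of fun i j => if (j : ℕ) = ((i : ℕ) + 1) % m then 1 else 0

/-- the filtration `𝓕_n = σ(R_0, …, R_n)`. -/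
def urnFilt {Ω : Type*} [MeasurableSpace Ω] (m : ℕ) (R : ℕ → Ω → Fin m → ℝ) (n : ℕ) :
    MeasurableSpace Ω :=
  ⨆ i ∈ Finset.range (n + 1), MeasurableSpace.comap (R i) inferInstance

/-- A cyclic urn process with `m` types started with one ball of type `j0`. -/
structure IsCyclicUrn {Ω : Type*} [MeasurableSpace Ω] (μ : Measure Ω) (m : ℕ) (j0 : Fin m)
    (R : ℕ → Ω → Fin m → ℝ) : Prop where
  isProb : IsProbabilityMeasure μ
  meas : ∀ n, Measurable (R n)
  natVal : ∀ n ω i, ∃ z : ℕ, R n ω i = z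
  init : ∀ ω, R 0 ω = fun i => if i = j0 then 1 else 0
  step : ∀ n, ∀ j : Fin m,
    μ[Set.indicator {ω | R (n + 1) ω =
        fun i => R n ω i + if (i : ℕ) = ((j : ℕ) + 1) % m then 1 else 0}
      (fun _ => (1 : ℝ)) | urnFilt m R n]
      =ᵐ[μ] fun ω => R n ω j / (n + 1)

/-- componentwise expectation `E[X]` of a random vector. -/
def expVec {Ω : Type*} [MeasurableSpace Ω] (μ : Measure Ω) {m : ℕ}
    (X : Ω → Fin m → ℝ) : Fin m → ℝ := fun i => ∫ ω, X ω i ∂μ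

/-- the martingale `M_{k,n} = (Γ(n+1)/Γ(n+1+ω^k)) u_k(R_n - E[R_n])`, with `M_{k,0} = 0`. -/
def Mart {Ω : Type*} [MeasurableSpace Ω] (μ : Measure Ω) (m k : ℕ)
    (R : ℕ → Ω → Fin m → ℝ) (n : ℕ) (ω : Ω) : ℂ :=
  if n = 0 then 0
  else (Complex.Gamma ((n : ℂ) + 1) / Complex.Gamma ((n : ℂ) + 1 + cw m ^ k)) *
    ucoef m k (fun t => R n ω t - expVec μ (R n) t)

/-- `ν` is the centered Gaussian distribution `𝒩(0, S)` on `ℝ^d` (Cramér–Wold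
characterization: every linear functional is one-dimensional centered Gaussian). -/
def IsCenteredGaussian {d : ℕ} (ν : Measure (Fin d → ℝ)) (S : Matrix (Fin d) (Fin d) ℝ) : Prop :=
  IsProbabilityMeasure ν ∧
  ∀ l : Fin d → ℝ,
    ν.map (fun x => ∑ i, l i * x i) =
      gaussianReal 0 (Real.toNNReal (∑ i, ∑ j, l i * S i j * l j))

/-- convergence in distribution of the random vectors `X_n` to the law `ν`. -/
def TendstoInDist {Ω : Type*} [MeasurableSpace Ω] (μ : Measure Ω) {d : ℕ}
    (X : ℕ → Ω → Fin d → ℝ) (ν : Measure (Fin d → ℝ)) : Prop :=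
  ∀ f : BoundedContinuousFunction (Fin d → ℝ) ℝ,
    Tendsto (fun n => ∫ ω, f (X n ω) ∂μ) atTop (𝓝 (∫ x, f x ∂ν))


/-- the toll function `g_k(u) = (1/Γ(1+ω^k))(u^{ω^k} + ω^k (1-u)^{ω^k} - 1)`. -/
def gfun (m k : ℕ) (u : ℝ) : ℂ :=
  (Complex.Gamma (1 + cw m ^ k))⁻¹ *
    ((u : ℂ) ^ (cw m ^ k) + cw m ^ k * ((1 : ℂ) - (u : ℂ)) ^ (cw m ^ k) - 1)

/-- The uniform probability measure on `Fin (n + 1)`. -/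
def unifFin (n : ℕ) : Measure (Fin (n + 1)) := ((n : ENNReal) + 1)⁻¹ • Measure.count

instance (n : ℕ) : IsProbabilityMeasure (unifFin n) := by
  constructor
  simp only [unifFin, Measure.smul_apply, Measure.count_univ, smul_eq_mul,
    ENat.card_eq_coe_fintype_card,
    Fintype.card_fin]
  push_cast
  exact ENNReal.inv_mul_cancel (by simp) (by finiteness)

lemma unifFin_apply (n : ℕ) (s : Set (Fin (n + 1))) :
    unifFin n s = ((n : ENNReal) + 1)⁻¹ * ∑ x, s.indicator 1 x := by
  have hs : MeasurableSet s := MeasurableSet.of_discrete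
  rw [unifFin, Measure.smul_apply, smul_eq_mul, ← lintegral_indicator_one hs, lintegral_count,
    tsum_fintype]

/-- The law of a sequence of independent choices, the `n`th one uniform on `Fin (n + 1)`. -/
def choiceLaw : Measure (∀ n : ℕ, Fin (n + 1)) := Measure.infinitePi unifFin

instance : IsProbabilityMeasure choiceLaw := by unfold choiceLaw; infer_instance

lemma choiceLaw_eq_sum_update (n : ℕ) :
    choiceLaw = ((n : ENNReal) + 1)⁻¹ •
      ∑ x : Fin (n + 1), choiceLaw.map (fun a => Function.update a n x) := by
  have hm : ∀ x : Fin (n + 1), Measurable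
      (fun a : (∀ n : ℕ, Fin (n + 1)) => Function.update a n x) := fun x => by fun_prop
  symm
  refine Measure.eq_infinitePi _ fun s t ht => ?_
  have hbox : MeasurableSet ((s : Set ℕ).pi t) :=
    MeasurableSet.pi s.countable_toSet fun i _ => ht i
  simp only [Measure.smul_apply, Measure.finsetSum_apply, smul_eq_mul,
    Measure.map_apply (hm _) hbox]
  by_cases hn : n ∈ s
  · have h1 : ∀ x : Fin (n + 1), choiceLaw ((fun a => Function.update a n x) ⁻¹' (s : Set ℕ).pi t)
        = (t n).indicator 1 x * ∏ i ∈ s.erase n, unifFin i (t i) := by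
      intro x
      by_cases hx : x ∈ t n
      · rw [choiceLaw, ← Measure.infinitePi_pi _ (fun i _ => ht i), Set.indicator_of_mem hx,
          Pi.one_apply, one_mul]
        congr 1
        ext a
        simp only [Set.mem_preimage, Set.mem_pi, Finset.mem_coe, Finset.mem_erase]
        constructor
        · intro h i hi
          simpa [Function.update_of_ne hi.1] using h i hi.2
        · intro h i hi
          by_cases hin : i = n
          · subst hin; simpa using hx
          · simpa [Function.update_of_ne hin] using h i ⟨hin, hi⟩
      · rw [Set.indicator_of_notMem hx, zero_mul]
        convert measure_empty (μ := choiceLaw)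
        ext a
        simp only [Set.mem_preimage, Set.mem_pi, Finset.mem_coe, Set.mem_empty_iff_false, iff_false]
        intro h
        exact hx (by simpa using h n hn)
    simp_rw [h1]
    rw [← Finset.sum_mul, ← mul_assoc, ← unifFin_apply]
    exact Finset.mul_prod_erase s (fun i => unifFin i (t i)) hn
  · have h1 : ∀ x : Fin (n + 1), choiceLaw ((fun a => Function.update a n x) ⁻¹' (s : Set ℕ).pi t)
        = ∏ i ∈ s, unifFin i (t i) := by
      intro x
      rw [choiceLaw, ← Measure.infinitePi_pi _ (fun i _ => ht i)]
      congr 1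
      ext a
      simp only [Set.mem_preimage, Set.mem_pi, Finset.mem_coe]
      refine forall₂_congr fun i hi => ?_
      rw [Function.update_of_ne (by rintro rfl; exact hn hi)]
    simp_rw [h1]
    rw [Finset.sum_const, Finset.card_univ, Fintype.card_fin, nsmul_eq_mul, ← mul_assoc]
    push_cast
    rw [ENNReal.inv_mul_cancel (by simp) (by finiteness), one_mul]

lemma lintegral_choiceLaw_update (n : ℕ) {f : (∀ n : ℕ, Fin (n + 1)) → ENNReal}
    (hf : Measurable f) :
    ∫⁻ a, f a ∂choiceLaw =
      ∫⁻ a, ((n : ENNReal) + 1)⁻¹ * ∑ x : Fin (n + 1), f (Function.update a n x) ∂choiceLaw := by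
  have hm : ∀ x : Fin (n + 1), Measurable
      (fun a : (∀ n : ℕ, Fin (n + 1)) => Function.update a n x) := fun x => by fun_prop
  conv_lhs => rw [choiceLaw_eq_sum_update n]
  rw [lintegral_smul_measure, lintegral_finsetSum_measure, lintegral_const_mul,
    lintegral_finsetSum (f := fun x a => f (Function.update a n x)) _
      (fun x _ => hf.comp (hm x)), smul_eq_mul]
  · simp_rw [lintegral_map hf (hm _)]
  · exact Finset.measurable_sum _ fun x _ => hf.comp (hm x)

lemma integral_choiceLaw_update (n : ℕ) {f : (∀ n : ℕ, Fin (n + 1)) → ℝ}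
    (hf : Measurable f) {C : ℝ} (hC : ∀ a, |f a| ≤ C) :
    ∫ a, f a ∂choiceLaw =
      ∫ a, ((n : ℝ) + 1)⁻¹ * ∑ x : Fin (n + 1), f (Function.update a n x) ∂choiceLaw := by
  have hm : ∀ x : Fin (n + 1), Measurable
      (fun a : (∀ n : ℕ, Fin (n + 1)) => Function.update a n x) := fun x => by fun_prop
  have hintegrable : ∀ x : Fin (n + 1), Integrable (fun a => f (Function.update a n x)) choiceLaw :=
    fun x => Integrable.of_bound (hf.comp (hm x)).aestronglyMeasurable C
      (Eventually.of_forall fun a => hC _)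
  conv_lhs => rw [choiceLaw_eq_sum_update n]
  rw [integral_smul_measure, integral_finsetSum_measure, integral_const_mul,
    integral_finsetSum _ (fun x _ => hintegrable x), smul_eq_mul]
  · simp_rw [integral_map (hm _).aemeasurable hf.aestronglyMeasurable]
    congr 1
    rw [ENNReal.toReal_inv, ENNReal.toReal_add (by finiteness) (by finiteness)]
    simp
  · intro x _
    rw [integrable_map_measure hf.aestronglyMeasurable (hm _).aemeasurable]
    exact hintegrable x

/-- The type following `j` in the cyclic order. -/
def rot {m : ℕ} (j : Fin m) : Fin m := ⟨((j : ℕ) + 1) % m, Nat.mod_lt _ j.pos⟩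

lemma rot_injective {m : ℕ} : Function.Injective (rot : Fin m → Fin m) := by
  intro i j h
  have h' : ((i : ℕ) + 1) ≡ ((j : ℕ) + 1) [MOD m] := congrArg Fin.val h
  have := Nat.ModEq.add_right_cancel' 1 h'
  exact Fin.ext (Nat.ModEq.eq_of_lt_of_lt this i.2 j.2)

/-- The composition of the urn after a ball of type `j` has been drawn. -/
def addBall {m : ℕ} (w : Fin m → ℝ) (j : Fin m) : Fin m → ℝ :=
  fun i => w i + if (i : ℕ) = ((j : ℕ) + 1) % m then 1 else 0

lemma addBall_apply {m : ℕ} (w : Fin m → ℝ) (j i : Fin m) :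
    addBall w j i = w i + if i = rot j then 1 else 0 := by
  simp [addBall, rot, Fin.ext_iff]

lemma addBall_injective {m : ℕ} (w : Fin m → ℝ) : Function.Injective (addBall w) := by
  intro i j h
  have h1 := congrFun h (rot i)
  simp only [addBall_apply, if_true, add_right_inj] at h1
  by_contra hne
  rw [if_neg fun h => hne (rot_injective h)] at h1
  exact one_ne_zero h1

lemma measurable_addBall {m : ℕ} (j : Fin m) : Measurable fun w : Fin m → ℝ => addBall w j := by
  unfold addBall; fun_prop

/-- The composition of a family of balls with types given by `f`. -/
def typeCount {m N : ℕ} (f : Fin N → Fin m) : Fin m → ℝ := fun j => ∑ x, if f x = j then 1 else 0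

lemma typeCount_snoc {m N : ℕ} (f : Fin N → Fin m) (y : Fin m) :
    typeCount (Fin.snoc (α := fun _ => Fin m) f y) =
      fun i => typeCount f i + if i = y then 1 else 0 := by
  ext i
  simp only [typeCount, Fin.sum_univ_castSucc, Fin.snoc_castSucc, Fin.snoc_last, @eq_comm _ y i]

lemma typeCount_nonneg {m N : ℕ} (f : Fin N → Fin m) (j : Fin m) : 0 ≤ typeCount f j :=
  Finset.sum_nonneg fun x _ => by split_ifs <;> norm_num

lemma typeCount_le {m N : ℕ} (f : Fin N → Fin m) (j : Fin m) : typeCount f j ≤ N := by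
  calc typeCount f j ≤ ∑ x : Fin N, (1 : ℝ) :=
        Finset.sum_le_sum fun x _ => by split_ifs <;> norm_num
    _ = N := by simp

lemma exists_nat_typeCount {m N : ℕ} (f : Fin N → Fin m) (j : Fin m) :
    ∃ z : ℕ, typeCount f j = z :=
  ⟨∑ x, if f x = j then 1 else 0, by simp [typeCount]⟩

/-- The types of the `n + 1` balls present after `n` draws, when the `i`th draw picks the ball
with label `c i`, starting from one ball of type `j0`. -/
def urnTypes {m : ℕ} (j0 : Fin m) (c : ∀ n : ℕ, Fin (n + 1)) : ∀ n : ℕ, Fin (n + 1) → Fin m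
  | 0 => fun _ => j0
  | n + 1 => Fin.snoc (α := fun _ => Fin m) (urnTypes j0 c n) (rot (urnTypes j0 c n (c n)))

lemma typeCount_urnTypes_zero {m : ℕ} (j0 : Fin m) (c : ∀ n : ℕ, Fin (n + 1)) :
    typeCount (urnTypes j0 c 0) = fun i => if i = j0 then 1 else 0 := by
  ext i
  rcases eq_or_ne j0 i with h | h
  · simp [typeCount, urnTypes, h]
  · simp [typeCount, urnTypes, h, h.symm]

lemma typeCount_urnTypes_succ {m : ℕ} (j0 : Fin m) (c : ∀ n : ℕ, Fin (n + 1)) (n : ℕ) :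
    typeCount (urnTypes j0 c (n + 1)) =
      addBall (typeCount (urnTypes j0 c n)) (urnTypes j0 c n (c n)) := by
  rw [urnTypes, typeCount_snoc]
  ext i
  rw [addBall_apply]

lemma typeCount_rot_urnTypes_succ {m : ℕ} (j0 : Fin m) (c : ∀ n : ℕ, Fin (n + 1)) (n : ℕ) :
    typeCount (rot ∘ urnTypes j0 c (n + 1)) =
      addBall (typeCount (rot ∘ urnTypes j0 c n)) (rot (urnTypes j0 c n (c n))) := by
  rw [urnTypes, Fin.comp_snoc, typeCount_snoc]
  ext i
  rw [addBall_apply]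

lemma urnTypes_update {m : ℕ} (j0 : Fin m) (c : ∀ n : ℕ, Fin (n + 1)) {i n : ℕ} (hin : i ≤ n)
    (x : Fin (n + 1)) : urnTypes j0 (Function.update c n x) i = urnTypes j0 c i := by
  induction i with
  | zero => rfl
  | succ i ih =>
    rw [urnTypes, urnTypes, ih (by omega), Function.update_of_ne (by omega)]

lemma measurable_urnTypes {m : ℕ} (j0 : Fin m) (n : ℕ) :
    Measurable fun c : (∀ n : ℕ, Fin (n + 1)) => urnTypes j0 c n := by
  induction n with
  | zero => exact measurable_const
  | succ n ih =>
    have h : Measurable fun p : (Fin (n + 1) → Fin m) × Fin (n + 1) =>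
        (Fin.snoc (α := fun _ => Fin m) p.1 (rot (p.1 p.2)) : Fin (n + 2) → Fin m) :=
      Measurable.of_discrete
    exact h.comp (ih.prodMk (measurable_pi_apply n))

lemma measurable_typeCount_urnTypes {m : ℕ} (j0 : Fin m) (n : ℕ) :
    Measurable fun c : (∀ n : ℕ, Fin (n + 1)) => typeCount (urnTypes j0 c n) :=
  (Measurable.of_discrete (f := fun f : Fin (n + 1) → Fin m => typeCount f)).comp
    (measurable_urnTypes j0 n)

lemma cw_pow_self {m : ℕ} (hm : m ≠ 0) : cw m ^ m = 1 := by
  rw [cw, ← Complex.exp_nat_mul, mul_div_cancel₀ _ (by exact_mod_cast hm), Complex.exp_two_pi_mul_I]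

lemma norm_cw (m : ℕ) : ‖cw m‖ = 1 := by
  rw [cw, show (2 * Real.pi * Complex.I / m : ℂ) = ((2 * Real.pi / m : ℝ) : ℂ) * Complex.I by
    push_cast; ring, Complex.norm_exp_ofReal_mul_I]

lemma re_cw_pow (m k : ℕ) : (cw m ^ k).re = lam m k := by
  rw [cw, ← Complex.exp_nat_mul, lam, show (k * (2 * Real.pi * Complex.I / m) : ℂ) =
    ((2 * Real.pi * k / m : ℝ) : ℂ) * Complex.I by push_cast; ring, Complex.exp_ofReal_mul_I_re]

lemma cw_pow_rot {m : ℕ} (k : ℕ) (j : Fin m) :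
    (cw m ^ k) ^ ((rot j : Fin m) : ℕ) = cw m ^ k * (cw m ^ k) ^ (j : ℕ) := by
  have h : (cw m ^ k) ^ m = 1 := by
    rw [← pow_mul, mul_comm, pow_mul, cw_pow_self (by have := j.pos; omega), one_pow]
  rw [← pow_succ', ← Nat.div_add_mod ((j : ℕ) + 1) m, pow_add, pow_mul, h, one_pow, one_mul, rot]

lemma ucoef_typeCount {m N : ℕ} (k : ℕ) (f : Fin N → Fin m) :
    ucoef m k (typeCount f) = ∑ x, (cw m ^ k) ^ ((f x : Fin m) : ℕ) := by
  simp only [ucoef, typeCount, Complex.ofReal_sum, Finset.mul_sum]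
  rw [Finset.sum_comm]
  refine Finset.sum_congr rfl fun x _ => ?_
  rw [Finset.sum_eq_single (f x)]
  · simp [pow_mul]
  · intro j _ hj; simp [hj.symm]
  · simp

lemma ucoef_addBall {m : ℕ} (k : ℕ) (w : Fin m → ℝ) (j : Fin m) :
    ucoef m k (addBall w j) = ucoef m k w + cw m ^ k * (cw m ^ k) ^ (j : ℕ) := by
  rw [← cw_pow_rot]
  simp only [ucoef, addBall_apply, Complex.ofReal_add, mul_add, Finset.sum_add_distrib]
  congr 1
  rw [Finset.sum_eq_single (rot j)]
  · simp [pow_mul]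
  · intro i _ hi; simp [hi]
  · simp

lemma ucoef_typeCount_rot {m N : ℕ} (k : ℕ) (f : Fin N → Fin m) :
    ucoef m k (typeCount (rot ∘ f)) = cw m ^ k * ucoef m k (typeCount f) := by
  simp [ucoef_typeCount, cw_pow_rot, Finset.mul_sum]

lemma norm_ucoef_typeCount_le {m N : ℕ} (k : ℕ) (f : Fin N → Fin m) :
    ‖ucoef m k (typeCount f)‖ ≤ N := by
  rw [ucoef_typeCount]
  refine (norm_sum_le _ _).trans ?_
  simp [norm_cw]

lemma measurable_ucoef (m k : ℕ) : Measurable (ucoef m k) := by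
  unfold ucoef; fun_prop

/-- The normalising factor `Γ(n + 1) / Γ(n + 1 + s)`. -/
def gammaRatio (s : ℂ) (n : ℕ) : ℂ :=
  Complex.Gamma ((n : ℂ) + 1) / Complex.Gamma ((n : ℂ) + 1 + s)

lemma gammaRatio_zero (s : ℂ) : gammaRatio s 0 = (Complex.Gamma (1 + s))⁻¹ := by
  simp [gammaRatio]

lemma gammaRatio_ne_zero {s : ℂ} (hs : 0 < s.re) (n : ℕ) : gammaRatio s n ≠ 0 := by
  refine div_ne_zero (Complex.Gamma_ne_zero_of_re_pos ?_) (Complex.Gamma_ne_zero_of_re_pos ?_)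
  · simp; positivity
  · simp; positivity

lemma gammaRatio_succ {s : ℂ} (hs : 0 < s.re) (n : ℕ) :
    gammaRatio s (n + 1) * (1 + s / ((n : ℂ) + 1)) = gammaRatio s n := by
  have h1 : ((n : ℂ) + 1) ≠ 0 := by exact_mod_cast n.succ_ne_zero
  have h2 : ((n : ℂ) + 1 + s) ≠ 0 := by
    intro h
    have := congrArg Complex.re h
    simp at this
    have : (0 : ℝ) ≤ n := n.cast_nonneg
    linarith
  have h3 : Complex.Gamma ((n : ℂ) + 1 + s) ≠ 0 :=
    Complex.Gamma_ne_zero_of_re_pos (by simp; positivity)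
  unfold gammaRatio
  push_cast
  rw [Complex.Gamma_add_one _ h1, show ((n : ℂ) + 1 + 1 + s) = ((n : ℂ) + 1 + s) + 1 by ring,
    Complex.Gamma_add_one _ h2]
  field_simp

lemma Gamma_add_nat_add_one {s : ℂ} (hs : 0 < s.re) (n : ℕ) :
    Complex.Gamma ((n : ℂ) + 1 + s) = (∏ j ∈ Finset.range (n + 1), (s + j)) * Complex.Gamma s := by
  have hne : ∀ n : ℕ, s + n ≠ 0 := by
    intro n h
    have := congrArg Complex.re h
    simp at this
    have : (0 : ℝ) ≤ n := n.cast_nonneg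
    linarith
  induction n with
  | zero =>
    have := hne 0
    simp only [Nat.cast_zero, add_zero] at this
    simp [add_comm (1 : ℂ) s, Complex.Gamma_add_one _ this]
  | succ n ih =>
    rw [Finset.prod_range_succ, show (((n + 1 : ℕ) : ℂ) + 1 + s) = ((n : ℂ) + 1 + s) + 1 by
      push_cast; ring, Complex.Gamma_add_one, ih]
    · push_cast; ring
    · have := hne (n + 1)
      rwa [add_comm, Nat.cast_succ] at this

lemma tendsto_cpow_mul_gammaRatio {s : ℂ} (hs : 0 < s.re) :
    Tendsto (fun n : ℕ => (n : ℂ) ^ s * gammaRatio s n) atTop (𝓝 1) := by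
  have hG : Complex.Gamma s ≠ 0 := Complex.Gamma_ne_zero_of_re_pos hs
  have h := (Complex.GammaSeq_tendsto_Gamma s).div_const (Complex.Gamma s)
  rw [div_self hG] at h
  refine h.congr fun n => ?_
  rw [gammaRatio, Gamma_add_nat_add_one hs, Complex.GammaSeq, Complex.Gamma_nat_eq_factorial,
    ← mul_div_assoc, div_div]

lemma summable_norm_gammaRatio_sq {s : ℂ} (hs : 1 / 2 < s.re) :
    Summable fun n : ℕ => ‖gammaRatio s n‖ ^ 2 := by
  have h := (tendsto_cpow_mul_gammaRatio (s := s) (by linarith)).norm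
  rw [norm_one] at h
  have h2 : ∀ᶠ n : ℕ in atTop, ‖‖gammaRatio s n‖ ^ 2‖ ≤ 4 * (n : ℝ) ^ (-(2 * s.re)) := by
    filter_upwards [h.eventually (ge_mem_nhds (show (1 : ℝ) < 2 by norm_num)),
      eventually_gt_atTop 0] with n hn hn0
    have hn' : (0 : ℝ) < n := by exact_mod_cast hn0
    rw [norm_mul, Complex.norm_natCast_cpow_of_pos hn0] at hn
    have hp : 0 < (n : ℝ) ^ s.re := Real.rpow_pos_of_pos hn' _
    rw [norm_pow, norm_norm, Real.rpow_neg hn'.le, two_mul, Real.rpow_add hn', ← div_eq_mul_inv,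
      le_div_iff₀ (by positivity)]
    nlinarith [norm_nonneg (gammaRatio s n), mul_nonneg hp.le (norm_nonneg (gammaRatio s n))]
  refine Summable.of_norm_bounded_eventually_nat ?_ h2
  exact (Real.summable_nat_rpow.2 (by linarith)).mul_left 4

lemma martingale_natural_of_update (r : ℕ) {X : ℕ → (∀ n : ℕ, Fin (n + 1)) → ℝ}
    (hX : ∀ n, Measurable (X n)) (C : ℕ → ℝ) (hC : ∀ n a, |X n a| ≤ C n)
    (hinv : ∀ n i, i ≤ n → ∀ a x, X i (Function.update a (n + r) x) = X i a)
    (havg : ∀ n a, (((n + r : ℕ) : ℝ) + 1)⁻¹ *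
      ∑ x : Fin (n + r + 1), X (n + 1) (Function.update a (n + r) x) = X n a) :
    Martingale X (Filtration.natural X fun n => (hX n).stronglyMeasurable) choiceLaw := by
  refine martingale_of_setIntegral_eq_succ (Filtration.stronglyAdapted_natural _)
    (fun n => Integrable.of_bound (hX n).aestronglyMeasurable (C n)
      (Eventually.of_forall fun a => hC n a)) ?_
  intro n E hE
  classical
  have hE' : MeasurableSet E := (Filtration.natural X _).le n E hE
  rw [Filtration.natural_eq_comap] at hE
  obtain ⟨t, -, rfl⟩ := hE
  rw [← integral_indicator hE', ← integral_indicator hE',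
    integral_choiceLaw_update (n + r) ((hX (n + 1)).indicator hE') (C := C (n + 1))]
  · congr 1
    ext a
    have hmem : ∀ x, Function.update a (n + r) x ∈
        (fun ω (j : Set.Iic n) => X j ω) ⁻¹' t ↔ a ∈ (fun ω (j : Set.Iic n) => X j ω) ⁻¹' t := by
      intro x
      simp only [Set.mem_preimage]
      rw [show (fun j : Set.Iic n => X j (Function.update a (n + r) x)) =
        fun j : Set.Iic n => X j a from funext fun j => hinv n j j.2 a x]
    by_cases ha : a ∈ (fun ω (j : Set.Iic n) => X j ω) ⁻¹' t
    · simp only [Set.indicator_of_mem ha, Set.indicator_of_mem ((hmem _).2 ha), havg]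
    · simp only [Set.indicator_of_notMem ha, Set.indicator_of_notMem (mt (hmem _).1 ha),
        Finset.sum_const_zero, mul_zero]
  · intro a
    refine le_trans ?_ (hC (n + 1) a)
    rw [Set.indicator_apply]
    split_ifs
    · rfl
    · simp

/-- An `L¹`-bounded sequence with the martingale property under resampling converges a.s. -/
lemma exists_tendsto_of_update (r : ℕ) {X : ℕ → (∀ n : ℕ, Fin (n + 1)) → ℝ}
    (hX : ∀ n, Measurable (X n)) (C : ℕ → ℝ) (hC : ∀ n a, |X n a| ≤ C n)
    (hinv : ∀ n i, i ≤ n → ∀ a x, X i (Function.update a (n + r) x) = X i a)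
    (havg : ∀ n a, (((n + r : ℕ) : ℝ) + 1)⁻¹ *
      ∑ x : Fin (n + r + 1), X (n + 1) (Function.update a (n + r) x) = X n a)
    (B : ℝ) (hB : ∀ n, ∫ a, |X n a| ∂choiceLaw ≤ B) :
    ∀ᵐ a ∂choiceLaw, ∃ l, Tendsto (fun n => X n a) atTop (𝓝 l) := by
  refine (martingale_natural_of_update r hX C hC hinv havg).submartingale.exists_ae_tendsto_of_bdd
    (R := B.toNNReal) fun n => ?_
  have hintegrable : Integrable (X n) choiceLaw :=
    Integrable.of_bound (hX n).aestronglyMeasurable (C n)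
      (Eventually.of_forall fun a => hC n a)
  rw [eLpNorm_one_eq_lintegral_enorm, ← ofReal_integral_norm_eq_lintegral_enorm hintegrable]
  exact ENNReal.ofReal_le_ofReal (hB n)

lemma sum_norm_add_sq_le {N : ℕ} (u : ℂ) (f : Fin (N + 1) → ℂ) (hf : ∀ x, ‖f x‖ = 1) :
    ((N : ℝ) + 1)⁻¹ * ∑ x, ‖u + f x‖ ^ 2 ≤ ‖u + ((N : ℂ) + 1)⁻¹ * ∑ x, f x‖ ^ 2 + 1 := by
  have hN : (0 : ℝ) < (N : ℝ) + 1 := by positivity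
  set t := ((N : ℂ) + 1)⁻¹ * ∑ x, f x with ht
  have hsum : ∑ x, f x = (((N : ℝ) + 1 : ℝ) : ℂ) * t := by
    rw [ht]; push_cast; rw [mul_inv_cancel_left₀]; exact_mod_cast N.succ_ne_zero
  have hre : ∑ x, (f x).re = (N + 1) * t.re := by
    rw [← Complex.re_sum, hsum, Complex.re_ofReal_mul]
  have him : ∑ x, (f x).im = (N + 1) * t.im := by
    rw [← Complex.im_sum, hsum, Complex.im_ofReal_mul]
  have h1 : ∀ x, ‖u + f x‖ ^ 2 = ‖u‖ ^ 2 + 2 * u.re * (f x).re + 2 * u.im * (f x).im + 1 := by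
    intro x
    have := hf x
    have h2 : ‖f x‖ ^ 2 = 1 := by rw [this, one_pow]
    rw [Complex.sq_norm, Complex.normSq_apply] at h2
    rw [Complex.sq_norm, Complex.sq_norm, Complex.normSq_apply, Complex.normSq_apply]
    simp only [Complex.add_re, Complex.add_im]
    linear_combination h2
  simp_rw [h1]
  rw [Finset.sum_add_distrib, Finset.sum_add_distrib, Finset.sum_add_distrib, ← Finset.mul_sum,
    ← Finset.mul_sum, hre, him]
  simp only [Finset.sum_const, Finset.card_univ, Fintype.card_fin, nsmul_eq_mul]
  rw [inv_mul_le_iff₀ hN, Complex.sq_norm, Complex.sq_norm, Complex.normSq_apply,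
    Complex.normSq_apply]
  push_cast
  simp only [Complex.add_re, Complex.add_im]
  nlinarith [mul_nonneg hN.le (sq_nonneg t.re), mul_nonneg hN.le (sq_nonneg t.im)]

/-- The normalised `k`th spectral coordinate of the urn after `n` draws. -/
def urnW {m : ℕ} (k : ℕ) (j0 : Fin m) (n : ℕ) (c : ∀ n : ℕ, Fin (n + 1)) : ℂ :=
  gammaRatio (cw m ^ k) n * ucoef m k (typeCount (urnTypes j0 c n))

lemma measurable_urnW {m : ℕ} (k : ℕ) (j0 : Fin m) (n : ℕ) : Measurable (urnW k j0 n) :=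
  ((measurable_ucoef m k).comp (measurable_typeCount_urnTypes j0 n)).const_mul _

lemma norm_urnW_le {m : ℕ} (k : ℕ) (j0 : Fin m) (n : ℕ) (c : ∀ n : ℕ, Fin (n + 1)) :
    ‖urnW k j0 n c‖ ≤ ‖gammaRatio (cw m ^ k) n‖ * (n + 1) := by
  rw [urnW, norm_mul]
  gcongr
  exact_mod_cast norm_ucoef_typeCount_le k (urnTypes j0 c n)

lemma urnW_update {m : ℕ} (k : ℕ) (j0 : Fin m) {i n : ℕ} (hin : i ≤ n)
    (c : ∀ n : ℕ, Fin (n + 1)) (x : Fin (n + 1)) :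
    urnW k j0 i (Function.update c n x) = urnW k j0 i c := by
  rw [urnW, urnTypes_update j0 c hin, urnW]

lemma urnW_succ_update {m : ℕ} (k : ℕ) (j0 : Fin m) (n : ℕ)
    (c : ∀ n : ℕ, Fin (n + 1)) (x : Fin (n + 1)) :
    urnW k j0 (n + 1) (Function.update c n x) = gammaRatio (cw m ^ k) (n + 1) *
      (ucoef m k (typeCount (urnTypes j0 c n)) +
        cw m ^ k * (cw m ^ k) ^ (urnTypes j0 c n x : ℕ)) := by
  rw [urnW, typeCount_urnTypes_succ, urnTypes_update j0 c le_rfl, Function.update_self,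
    ucoef_addBall]

lemma gammaRatio_mul_avg {m : ℕ} {k : ℕ} (hs : 0 < (cw m ^ k).re) (j0 : Fin m) (n : ℕ)
    (c : ∀ n : ℕ, Fin (n + 1)) :
    gammaRatio (cw m ^ k) (n + 1) * (ucoef m k (typeCount (urnTypes j0 c n)) +
      ((n : ℂ) + 1)⁻¹ * ∑ x, cw m ^ k * (cw m ^ k) ^ (urnTypes j0 c n x : ℕ)) = urnW k j0 n c := by
  rw [← Finset.mul_sum, ← ucoef_typeCount, urnW, ← gammaRatio_succ hs n]
  ring

lemma avg_urnW_succ {m : ℕ} {k : ℕ} (hs : 0 < (cw m ^ k).re) (j0 : Fin m) (n : ℕ)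
    (c : ∀ n : ℕ, Fin (n + 1)) :
    ((n : ℝ) + 1)⁻¹ • ∑ x : Fin (n + 1), urnW k j0 (n + 1) (Function.update c n x)
      = urnW k j0 n c := by
  simp_rw [urnW_succ_update]
  rw [← gammaRatio_mul_avg hs, ← Finset.mul_sum, Finset.sum_add_distrib, Complex.real_smul]
  simp only [Finset.sum_const, Finset.card_univ, Fintype.card_fin, nsmul_eq_mul]
  have : (n : ℂ) + 1 ≠ 0 := by exact_mod_cast n.succ_ne_zero
  push_cast
  field_simp

lemma avg_norm_urnW_succ_sq_le {m : ℕ} {k : ℕ} (hs : 0 < (cw m ^ k).re) (j0 : Fin m) (n : ℕ)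
    (c : ∀ n : ℕ, Fin (n + 1)) :
    ((n : ℝ) + 1)⁻¹ * ∑ x : Fin (n + 1), ‖urnW k j0 (n + 1) (Function.update c n x)‖ ^ 2
      ≤ ‖urnW k j0 n c‖ ^ 2 + ‖gammaRatio (cw m ^ k) (n + 1)‖ ^ 2 := by
  have h := sum_norm_add_sq_le (ucoef m k (typeCount (urnTypes j0 c n)))
    (fun x => cw m ^ k * (cw m ^ k) ^ (urnTypes j0 c n x : ℕ)) (fun x => by simp [norm_cw])
  simp_rw [urnW_succ_update, norm_mul, mul_pow]
  rw [← gammaRatio_mul_avg hs, ← Finset.mul_sum, norm_mul, mul_pow]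
  calc _ = ‖gammaRatio (cw m ^ k) (n + 1)‖ ^ 2 * (((n : ℝ) + 1)⁻¹ *
        ∑ x, ‖ucoef m k (typeCount (urnTypes j0 c n)) +
          cw m ^ k * (cw m ^ k) ^ (urnTypes j0 c n x : ℕ)‖ ^ 2) := by ring
    _ ≤ _ := mul_le_mul_of_nonneg_left h (by positivity)
    _ = _ := by ring

lemma norm_urnW_zero {m : ℕ} (k : ℕ) (j0 : Fin m) (c : ∀ n : ℕ, Fin (n + 1)) :
    ‖urnW k j0 0 c‖ = ‖gammaRatio (cw m ^ k) 0‖ := by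
  simp [urnW, ucoef_typeCount, norm_cw]

lemma integral_norm_urnW_sq_le {m : ℕ} {k : ℕ} (hs : 0 < (cw m ^ k).re) (j0 : Fin m) (n : ℕ) :
    ∫ c, ‖urnW k j0 n c‖ ^ 2 ∂choiceLaw ≤
      ∑ i ∈ Finset.range (n + 1), ‖gammaRatio (cw m ^ k) i‖ ^ 2 := by
  have hb : ∀ n c, |‖urnW k j0 n c‖ ^ 2| ≤ (‖gammaRatio (cw m ^ k) n‖ * (n + 1)) ^ 2 := by
    intro n c
    rw [abs_of_nonneg (by positivity)]
    gcongr
    exact norm_urnW_le k j0 n c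
  have hmeas : ∀ n, Measurable fun c => ‖urnW k j0 n c‖ ^ 2 := fun n =>
    (measurable_urnW k j0 n).norm.pow_const 2
  have hintegrable : ∀ n, Integrable (fun c => ‖urnW k j0 n c‖ ^ 2) choiceLaw := fun n =>
    Integrable.of_bound (hmeas n).aestronglyMeasurable _ (Eventually.of_forall fun a => hb n a)
  induction n with
  | zero => simp [norm_urnW_zero]
  | succ n ih =>
    rw [integral_choiceLaw_update n (hmeas (n + 1)) (hb (n + 1)), Finset.sum_range_succ]
    calc _ ≤ ∫ c, (‖urnW k j0 n c‖ ^ 2 + ‖gammaRatio (cw m ^ k) (n + 1)‖ ^ 2) ∂choiceLaw := by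
          refine integral_mono_of_nonneg (Eventually.of_forall fun c => ?_)
            ((hintegrable n).add (integrable_const _))
            (Eventually.of_forall fun c => avg_norm_urnW_succ_sq_le hs j0 n c)
          simp only [Pi.zero_apply]
          positivity
      _ ≤ _ := by
          rw [integral_add (hintegrable n) (integrable_const _)]
          simpa using ih

lemma exists_tendsto_urnW {m : ℕ} {k : ℕ} (hs : 1 / 2 < (cw m ^ k).re) (j0 : Fin m) :
    ∃ W : (∀ n : ℕ, Fin (n + 1)) → ℂ, Measurable W ∧
      ∀ᵐ c ∂choiceLaw, Tendsto (fun n => urnW k j0 n c) atTop (𝓝 (W c)) := by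
  have hs0 : 0 < (cw m ^ k).re := by linarith
  have key : ∀ l : ℂ →L[ℝ] ℝ, (∀ z, |l z| ≤ ‖z‖) →
      ∀ᵐ c ∂choiceLaw, ∃ z, Tendsto (fun n => l (urnW k j0 n c)) atTop (𝓝 z) := by
    intro l hl
    refine exists_tendsto_of_update 0
      (fun n => l.continuous.measurable.comp (measurable_urnW k j0 n))
      (fun n => ‖gammaRatio (cw m ^ k) n‖ * (n + 1))
      (fun n c => (hl _).trans (norm_urnW_le k j0 n c))
      (fun n i hi a x => congrArg l (urnW_update k j0 hi a x))
      (fun n a => ?_) (1 + ∑' i, ‖gammaRatio (cw m ^ k) i‖ ^ 2) (fun n => ?_)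
    · have := congrArg l (avg_urnW_succ hs0 j0 n a)
      rw [map_smul, map_sum, smul_eq_mul] at this
      exact this
    · have hintegrable : Integrable (fun c => ‖urnW k j0 n c‖ ^ 2) choiceLaw :=
        Integrable.of_bound ((measurable_urnW k j0 n).norm.pow_const 2).aestronglyMeasurable
          ((‖gammaRatio (cw m ^ k) n‖ * (n + 1)) ^ 2) (Eventually.of_forall fun c => by
            rw [norm_pow, norm_norm]; gcongr; exact norm_urnW_le k j0 n c)
      calc ∫ a, |l (urnW k j0 n a)| ∂choiceLaw
          ≤ ∫ c, (1 + ‖urnW k j0 n c‖ ^ 2) ∂choiceLaw := by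
            refine integral_mono_of_nonneg (Eventually.of_forall fun c => abs_nonneg _)
              ((integrable_const _).add hintegrable) (Eventually.of_forall fun c => ?_)
            refine (hl _).trans ?_
            nlinarith [sq_nonneg (‖urnW k j0 n c‖ - 1), norm_nonneg (urnW k j0 n c)]
        _ ≤ _ := by
            rw [integral_add (integrable_const _) hintegrable]
            simp only [integral_const, probReal_univ, one_smul]
            gcongr
            exact (integral_norm_urnW_sq_le hs0 j0 n).trans
              ((summable_norm_gammaRatio_sq hs).sum_le_tsum _ fun i _ => by positivity)
  refine measurable_limit_of_tendsto_metrizable_ae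
    (fun n => (measurable_urnW k j0 n).aemeasurable) ?_
  filter_upwards [key Complex.reCLM Complex.abs_re_le_norm,
    key Complex.imCLM Complex.abs_im_le_norm] with c ⟨x, hx⟩ ⟨y, hy⟩
  refine ⟨(x : ℂ) + y * Complex.I, ?_⟩
  have h1 := (Complex.continuous_ofReal.tendsto x).comp hx
  have h2 := ((Complex.continuous_ofReal.tendsto y).comp hy).mul_const Complex.I
  refine (h1.add h2).congr fun n => ?_
  simp [Complex.re_add_im]

lemma integral_urnW {m : ℕ} {k : ℕ} (hs : 0 < (cw m ^ k).re) (j0 : Fin m) (n : ℕ) :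
    ∫ c, urnW k j0 n c ∂choiceLaw = gammaRatio (cw m ^ k) 0 * (cw m ^ k) ^ (j0 : ℕ) := by
  have hintegrable : ∀ n, Integrable (urnW k j0 n) choiceLaw := fun n =>
    Integrable.of_bound (measurable_urnW k j0 n).aestronglyMeasurable _
      (Eventually.of_forall fun c => norm_urnW_le k j0 n c)
  have key : ∀ l : ℂ →L[ℝ] ℝ, (∀ z, |l z| ≤ ‖z‖) →
      l (∫ c, urnW k j0 n c ∂choiceLaw) = l (gammaRatio (cw m ^ k) 0 * (cw m ^ k) ^ (j0 : ℕ)) := by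
    intro l hl
    induction n with
    | zero => simp [urnW, ucoef_typeCount, urnTypes]
    | succ n ih =>
      rw [← ih, ← l.integral_comp_comm (hintegrable _), ← l.integral_comp_comm (hintegrable _),
        integral_choiceLaw_update n (f := fun c => l (urnW k j0 (n + 1) c))
          (l.continuous.measurable.comp (measurable_urnW k j0 _))
          (fun c => (hl _).trans (norm_urnW_le k j0 _ c))]
      congr 1
      ext a
      have := congrArg l (avg_urnW_succ hs j0 n a)
      rw [map_smul, map_sum, smul_eq_mul] at this
      exact this
  exact Complex.ext (key Complex.reCLM Complex.abs_re_le_norm)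
    (key Complex.imCLM Complex.abs_im_le_norm)

/-- The number of draws `1, …, n` going to the left group in a two-colour Pólya urn started with
one ball of each colour. -/
def leftCount (d : ∀ n : ℕ, Fin (n + 1)) : ℕ → ℕ
  | 0 => 0
  | n + 1 => if (d (n + 1) : ℕ) ≤ leftCount d n then leftCount d n + 1 else leftCount d n

lemma leftCount_le (d : ∀ n : ℕ, Fin (n + 1)) (n : ℕ) : leftCount d n ≤ n := by
  induction n with
  | zero => exact le_rfl
  | succ n ih => rw [leftCount]; split_ifs <;> omega

lemma leftCount_le_succ (d : ∀ n : ℕ, Fin (n + 1)) (n : ℕ) :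
    leftCount d n ≤ leftCount d (n + 1) := by
  rw [leftCount]; split_ifs <;> omega

lemma leftCount_mono (d : ∀ n : ℕ, Fin (n + 1)) : Monotone (leftCount d) :=
  monotone_nat_of_le_succ (leftCount_le_succ d)

lemma sub_leftCount_mono (d : ∀ n : ℕ, Fin (n + 1)) : Monotone fun n => n - leftCount d n := by
  refine monotone_nat_of_le_succ fun n => ?_
  have := leftCount_le d n
  simp only [leftCount]; split_ifs <;> omega

lemma leftCount_update (d : ∀ n : ℕ, Fin (n + 1)) {i n : ℕ} (hin : i ≤ n) (x : Fin (n + 1 + 1)) :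
    leftCount (Function.update d (n + 1) x) i = leftCount d i := by
  induction i with
  | zero => rfl
  | succ i ih =>
    rw [leftCount, leftCount, ih (by omega), Function.update_of_ne (by omega)]

lemma leftCount_succ_update (d : ∀ n : ℕ, Fin (n + 1)) (n : ℕ) (x : Fin (n + 1 + 1)) :
    leftCount (Function.update d (n + 1) x) (n + 1) =
      if (x : ℕ) ≤ leftCount d n then leftCount d n + 1 else leftCount d n := by
  rw [leftCount, leftCount_update d le_rfl, Function.update_self]

lemma measurable_leftCount (n : ℕ) :
    Measurable fun d : (∀ n : ℕ, Fin (n + 1)) => leftCount d n := by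
  induction n with
  | zero => exact measurable_const
  | succ n ih =>
    have h : Measurable fun p : ℕ × Fin (n + 1 + 1) => if (p.2 : ℕ) ≤ p.1 then p.1 + 1 else p.1 :=
      Measurable.of_discrete
    exact h.comp (ih.prodMk (measurable_pi_apply (n + 1)))

lemma sum_fin_ite_le {M : Type*} [AddCommMonoid M] {l n : ℕ} (hl : l ≤ n) (a b : M) :
    ∑ x : Fin (n + 1 + 1), (if (x : ℕ) ≤ l then a else b) = (l + 1) • a + (n - l + 1) • b := by
  rw [Fin.sum_univ_eq_sum_range (fun x => if x ≤ l then a else b) (n + 1 + 1),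
    show n + 1 + 1 = (l + 1) + (n - l + 1) by omega, Finset.sum_range_add]
  congr 1
  · rw [Finset.sum_congr rfl fun x hx => if_pos (Nat.lt_succ_iff.1 (Finset.mem_range.1 hx))]
    simp
  · rw [Finset.sum_congr rfl fun x hx => if_neg (by omega)]
    simp

lemma exists_tendsto_leftCount :
    ∃ U : (∀ n : ℕ, Fin (n + 1)) → ℝ, Measurable U ∧
      ∀ᵐ d ∂choiceLaw, Tendsto (fun n : ℕ => ((leftCount d n : ℝ) + 1) / (n + 2)) atTop
        (𝓝 (U d)) := by
  have hmeas : ∀ n : ℕ, Measurable fun d : (∀ n : ℕ, Fin (n + 1)) =>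
      ((leftCount d n : ℝ) + 1) / (n + 2) := fun n =>
    (Measurable.of_discrete (f := fun i : ℕ => ((i : ℝ) + 1) / (n + 2))).comp
      (measurable_leftCount n)
  have hb : ∀ (n : ℕ) (d : ∀ n : ℕ, Fin (n + 1)), |((leftCount d n : ℝ) + 1) / (n + 2)| ≤ 1 := by
    intro n d
    rw [abs_of_nonneg (by positivity), div_le_one (by positivity)]
    have : (leftCount d n : ℝ) ≤ n := by exact_mod_cast leftCount_le d n
    linarith
  refine measurable_limit_of_tendsto_metrizable_ae (fun n => (hmeas n).aemeasurable) ?_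
  refine exists_tendsto_of_update 1 hmeas (fun _ => 1) hb (fun n i hi a x => ?_) (fun n a => ?_)
    1 (fun n => ?_)
  · simp only [leftCount_update a hi]
  · simp_rw [leftCount_succ_update]
    have hle := leftCount_le a n
    have h1 : ∀ x : Fin (n + 1 + 1), (((if (x : ℕ) ≤ leftCount a n then leftCount a n + 1
        else leftCount a n : ℕ) : ℝ) + 1) / (((n + 1 : ℕ) : ℝ) + 2) =
        if (x : ℕ) ≤ leftCount a n then ((leftCount a n : ℝ) + 2) / (n + 3)
        else ((leftCount a n : ℝ) + 1) / (n + 3) := by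
      intro x
      split_ifs <;> push_cast <;> ring
    simp_rw [h1]
    rw [sum_fin_ite_le hle]
    simp only [nsmul_eq_mul]
    push_cast [Nat.cast_sub hle]
    field_simp
    ring
  · calc _ ≤ ∫ a, (1 : ℝ) ∂choiceLaw := by
          refine integral_mono_of_nonneg (Eventually.of_forall fun c => abs_nonneg _)
            (integrable_const _) (Eventually.of_forall fun c => hb n c)
      _ = 1 := by simp

lemma integral_leftCount (f : ℕ → ℝ) (n : ℕ) :
    ∫ d, f (leftCount d n) ∂choiceLaw = ((n : ℝ) + 1)⁻¹ * ∑ i ∈ Finset.range (n + 1), f i := by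
  induction n generalizing f with
  | zero => simp [leftCount]
  | succ n ih =>
    have hmeas : Measurable fun d => f (leftCount d (n + 1)) :=
      (Measurable.of_discrete (f := f)).comp (measurable_leftCount _)
    rw [integral_choiceLaw_update (n + 1) hmeas (C := ∑ i ∈ Finset.range (n + 2), |f i|)]
    · have h1 : ∀ d : ∀ n : ℕ, Fin (n + 1), (((n + 1 : ℕ) : ℝ) + 1)⁻¹ * ∑ x : Fin (n + 1 + 1),
          f (leftCount (Function.update d (n + 1) x) (n + 1)) =
          (fun i : ℕ => ((n : ℝ) + 2)⁻¹ * (((i : ℝ) + 1) * f (i + 1) + ((n : ℝ) - i + 1) * f i))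
            (leftCount d n) := by
        intro d
        have hle := leftCount_le d n
        simp_rw [leftCount_succ_update, apply_ite f]
        rw [sum_fin_ite_le hle]
        simp only [nsmul_eq_mul]
        push_cast [Nat.cast_sub hle]
        ring
      refine (integral_congr_ae (Eventually.of_forall h1)).trans ((ih fun i : ℕ =>
        ((n : ℝ) + 2)⁻¹ * (((i : ℝ) + 1) * f (i + 1) + ((n : ℝ) - i + 1) * f i)).trans ?_)
      rw [← Finset.mul_sum, Finset.sum_add_distrib]
      have h2 := Finset.sum_range_succ' (fun i : ℕ => (i : ℝ) * f i) (n + 1)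
      have h3 := Finset.sum_range_succ (fun i : ℕ => ((n : ℝ) - i + 1) * f i) (n + 1)
      push_cast at h2 h3
      simp only [zero_mul, add_zero] at h2
      have h4 : ∑ i ∈ Finset.range (n + 1), ((n : ℝ) - i + 1) * f i =
          ∑ i ∈ Finset.range (n + 1 + 1), ((n : ℝ) - i + 1) * f i := by rw [h3]; ring
      rw [← h2, h4, ← Finset.sum_add_distrib]
      simp_rw [← add_mul]
      rw [Finset.sum_congr rfl fun i _ => by rw [show (i : ℝ) + (n - i + 1) = n + 1 by ring],
        ← Finset.mul_sum]
      push_cast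
      field_simp
      ring
    · intro d
      have := leftCount_le d (n + 1)
      exact Finset.single_le_sum (f := fun i => |f i|) (fun i _ => abs_nonneg _)
        (Finset.mem_range.2 (by omega))

lemma intervalIntegral_floor (f : ℕ → ℝ) (N : ℕ) :
    ∫ x in (0 : ℝ)..N, f ⌊x⌋₊ = ∑ i ∈ Finset.range N, f i := by
  have hEq : ∀ i : ℕ, Set.EqOn (fun x : ℝ => f ⌊x⌋₊) (fun _ => f i) (Set.Ico (i : ℝ) (i + 1)) := by
    intro i x hx
    simp only
    rw [Nat.floor_eq_on_Ico i x hx]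
  have hae : ∀ i : ℕ, (fun x : ℝ => f ⌊x⌋₊) =ᵐ[volume.restrict (Set.uIoc (i : ℝ) (i + 1 : ℕ))]
      fun _ => f i := by
    intro i
    rw [Set.uIoc_of_le (by push_cast; linarith), ← restrict_Ico_eq_restrict_Ioc]
    refine (ae_restrict_iff' measurableSet_Ico).2 (Eventually.of_forall fun x hx => ?_)
    exact hEq i (by exact_mod_cast hx)
  rw [← Nat.cast_zero,
    ← intervalIntegral.sum_integral_adjacent_intervals (a := fun i : ℕ => (i : ℝ))]
  · refine Finset.sum_congr rfl fun i _ => ?_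
    rw [intervalIntegral.integral_congr_ae_restrict (hae i)]
    simp
  · intro i _
    exact (intervalIntegrable_const (c := f i)).congr_ae (hae i).symm

lemma tendsto_avg_leftCount (f : BoundedContinuousFunction ℝ ℝ) :
    Tendsto (fun n : ℕ => ((n : ℝ) + 1)⁻¹ * ∑ i ∈ Finset.range (n + 1), f (((i : ℝ) + 1) / (n + 2)))
      atTop (𝓝 (∫ x in Set.Icc (0 : ℝ) 1, f x)) := by
  have h1 : ∀ n : ℕ, ((n : ℝ) + 1)⁻¹ * ∑ i ∈ Finset.range (n + 1), f (((i : ℝ) + 1) / (n + 2)) =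
      ∫ x in Set.Icc (0 : ℝ) 1, f (((⌊((n : ℝ) + 1) * x⌋₊ : ℝ) + 1) / (n + 2)) := by
    intro n
    rw [integral_Icc_eq_integral_Ioc, ← intervalIntegral.integral_of_le zero_le_one,
      intervalIntegral.integral_comp_mul_left
        (fun y : ℝ => f (((⌊y⌋₊ : ℝ) + 1) / (n + 2))) (by positivity), mul_zero, mul_one,
      smul_eq_mul, ← Nat.cast_succ,
      intervalIntegral_floor (fun i : ℕ => f (((i : ℝ) + 1) / (n + 2))) (n + 1)]
  simp_rw [h1]
  refine tendsto_integral_of_dominated_convergence (fun _ => ‖f‖) (fun n => ?_)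
    (integrable_const _) (fun n => Eventually.of_forall fun x => f.norm_coe_le_norm _) ?_
  · refine Measurable.aestronglyMeasurable ?_
    refine f.continuous.measurable.comp ?_
    refine Measurable.div_const (Measurable.add_const ?_ _) _
    exact (Measurable.of_discrete (f := fun i : ℕ => (i : ℝ))).comp
      (Nat.measurable_floor.comp (measurable_id.const_mul _))
  · refine (ae_restrict_iff' measurableSet_Icc).2 (Eventually.of_forall fun x hx => ?_)
    refine (f.continuous.tendsto x).comp ?_
    have h2 : Tendsto (fun n : ℕ => (n : ℝ) + 1) atTop atTop :=
      tendsto_atTop_add_const_right _ _ tendsto_natCast_atTop_atTop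
    have h3 := (tendsto_nat_floor_mul_div_atTop (R := ℝ) hx.1).comp h2
    have h4 : Tendsto (fun n : ℕ => ((n : ℝ) + 1)⁻¹) atTop (𝓝 0) := tendsto_inv_atTop_zero.comp h2
    have h5 := (h3.add h4).div (h4.const_add 1) (by norm_num)
    simp only [add_zero, div_one] at h5
    refine h5.congr fun n => ?_
    have : (n : ℝ) + 1 ≠ 0 := by positivity
    simp only [Function.comp_apply, Pi.div_apply, mul_comm x]
    rw [show (n : ℝ) + 2 = (n + 1) * (1 + ((n : ℝ) + 1)⁻¹) by field_simp; ring, ← div_div,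
      add_div _ (1 : ℝ) ((n : ℝ) + 1), one_div]

lemma map_eq_uniform_of_tendsto_leftCount {U : (∀ n : ℕ, Fin (n + 1)) → ℝ} (hU : Measurable U)
    (h : ∀ᵐ d ∂choiceLaw, Tendsto (fun n : ℕ => ((leftCount d n : ℝ) + 1) / (n + 2)) atTop
        (𝓝 (U d))) :
    choiceLaw.map U = volume.restrict (Set.Icc (0 : ℝ) 1) := by
  have := Measure.isProbabilityMeasure_map (μ := choiceLaw) hU.aemeasurable
  refine ext_of_forall_integral_eq_of_IsFiniteMeasure fun f => ?_
  rw [integral_map hU.aemeasurable f.continuous.measurable.aestronglyMeasurable]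
  refine tendsto_nhds_unique ?_ (tendsto_avg_leftCount f)
  simp_rw [← integral_leftCount (fun i : ℕ => f (((i : ℝ) + 1) / (_ + 2)))]
  refine tendsto_integral_of_dominated_convergence (fun _ => ‖f‖) (fun n => ?_)
    (integrable_const _) (fun n => Eventually.of_forall fun x => f.norm_coe_le_norm _) ?_
  · exact ((Measurable.of_discrete (f := fun i : ℕ => f (((i : ℝ) + 1) / (n + 2)))).comp
      (measurable_leftCount n)).aestronglyMeasurable
  · filter_upwards [h] with d hd
    exact (f.continuous.tendsto _).comp hd

lemma lintegral_prod_choiceLaw_update {β : Type*} [MeasurableSpace β] (ν : Measure β) [SFinite ν]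
    (n : ℕ) {F : β × (∀ n : ℕ, Fin (n + 1)) → ENNReal} (hF : Measurable F) :
    ∫⁻ p, F p ∂(ν.prod choiceLaw) = ∫⁻ p, ((n : ENNReal) + 1)⁻¹ *
      ∑ x : Fin (n + 1), F (p.1, Function.update p.2 n x) ∂(ν.prod choiceLaw) := by
  rw [lintegral_prod _ hF.aemeasurable, lintegral_prod]
  · refine lintegral_congr fun b => ?_
    exact lintegral_choiceLaw_update n (f := fun c => F (b, c)) (hF.comp measurable_prodMk_left)
  · refine Measurable.aemeasurable ?_
    refine (Finset.measurable_sum _ fun x _ => ?_).const_mul _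
    fun_prop

lemma lintegral_choiceLaw_prod_update {β : Type*} [MeasurableSpace β] (ν : Measure β) [SFinite ν]
    (n : ℕ) {F : (∀ n : ℕ, Fin (n + 1)) × β → ENNReal} (hF : Measurable F) :
    ∫⁻ p, F p ∂(choiceLaw.prod ν) = ∫⁻ p, ((n : ENNReal) + 1)⁻¹ *
      ∑ x : Fin (n + 1), F (Function.update p.1 n x, p.2) ∂(choiceLaw.prod ν) := by
  rw [lintegral_prod_symm _ hF.aemeasurable, lintegral_prod_symm]
  · refine lintegral_congr fun b => ?_
    exact lintegral_choiceLaw_update n (f := fun c => F (c, b)) (hF.comp measurable_prodMk_right)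
  · refine Measurable.aemeasurable ?_
    refine (Finset.measurable_sum _ fun x _ => ?_).const_mul _
    fun_prop

/-- The sample space carrying the choices of a Pólya urn and of two cyclic urns. -/
abbrev TripleChoices : Type :=
  ((∀ n : ℕ, Fin (n + 1)) × (∀ n : ℕ, Fin (n + 1))) × (∀ n : ℕ, Fin (n + 1))

/-- The law of three independent sequences of choices. -/
def tripleLaw : Measure TripleChoices := (choiceLaw.prod choiceLaw).prod choiceLaw

instance : IsProbabilityMeasure tripleLaw := by unfold tripleLaw; infer_instance

lemma lintegral_tripleLaw_update_fst (n : ℕ) {F : TripleChoices → ENNReal} (hF : Measurable F) :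
    ∫⁻ p, F p ∂tripleLaw = ∫⁻ p, ((n : ENNReal) + 1)⁻¹ *
      ∑ x : Fin (n + 1), F ((Function.update p.1.1 n x, p.1.2), p.2) ∂tripleLaw := by
  rw [tripleLaw, lintegral_prod_symm _ hF.aemeasurable, lintegral_prod_symm]
  · refine lintegral_congr fun b => ?_
    exact lintegral_choiceLaw_prod_update _ n (F := fun q => F (q, b))
      (hF.comp measurable_prodMk_right)
  · refine Measurable.aemeasurable ?_
    refine (Finset.measurable_sum _ fun x _ => ?_).const_mul _
    fun_prop

lemma lintegral_tripleLaw_update_snd (n : ℕ) {F : TripleChoices → ENNReal} (hF : Measurable F) :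
    ∫⁻ p, F p ∂tripleLaw = ∫⁻ p, ((n : ENNReal) + 1)⁻¹ *
      ∑ x : Fin (n + 1), F ((p.1.1, Function.update p.1.2 n x), p.2) ∂tripleLaw := by
  rw [tripleLaw, lintegral_prod_symm _ hF.aemeasurable, lintegral_prod_symm]
  · refine lintegral_congr fun b => ?_
    exact lintegral_prod_choiceLaw_update _ n (F := fun q => F (q, b))
      (hF.comp measurable_prodMk_right)
  · refine Measurable.aemeasurable ?_
    refine (Finset.measurable_sum _ fun x _ => ?_).const_mul _
    fun_prop

lemma lintegral_tripleLaw_update_thd (n : ℕ) {F : TripleChoices → ENNReal} (hF : Measurable F) :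
    ∫⁻ p, F p ∂tripleLaw = ∫⁻ p, ((n : ENNReal) + 1)⁻¹ *
      ∑ x : Fin (n + 1), F (p.1, Function.update p.2 n x) ∂tripleLaw :=
  lintegral_prod_choiceLaw_update _ n hF

/-- The urn obtained from two cyclic urns, the second one with shifted types, when a Pólya urn
decides which of the two draws next. -/
def mergedUrn {m : ℕ} (j0 : Fin m) : ℕ → TripleChoices → Fin m → ℝ
  | 0, p => typeCount (urnTypes j0 p.1.2 0)
  | n + 1, p => fun i => typeCount (urnTypes j0 p.1.2 (leftCount p.1.1 n)) i +
      typeCount (rot ∘ urnTypes j0 p.2 (n - leftCount p.1.1 n)) i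

/-- The type of the ball drawn from the merged urn. -/
def mergedPick {m : ℕ} (j0 : Fin m) : ℕ → TripleChoices → Fin m
  | 0, _ => j0
  | n + 1, p => if (p.1.1 (n + 1) : ℕ) ≤ leftCount p.1.1 n then
        urnTypes j0 p.1.2 (leftCount p.1.1 n) (p.1.2 (leftCount p.1.1 n))
      else rot (urnTypes j0 p.2 (n - leftCount p.1.1 n) (p.2 (n - leftCount p.1.1 n)))

lemma mergedUrn_succ {m : ℕ} (j0 : Fin m) (n : ℕ) (p : TripleChoices) :
    mergedUrn j0 (n + 1) p = addBall (mergedUrn j0 n p) (mergedPick j0 n p) := by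
  cases n with
  | zero =>
    ext i
    rw [addBall_apply]
    simp only [mergedUrn, mergedPick, leftCount]
    congr 1
    rcases eq_or_ne i (rot j0) with h | h
    · simp [typeCount, urnTypes, h]
    · simp [typeCount, urnTypes, h, h.symm]
  | succ n =>
    have hle := leftCount_le p.1.1 n
    ext i
    rw [addBall_apply]
    by_cases h : (p.1.1 (n + 1) : ℕ) ≤ leftCount p.1.1 n
    · have e : leftCount p.1.1 (n + 1) = leftCount p.1.1 n + 1 := by rw [leftCount, if_pos h]
      simp only [mergedUrn, mergedPick, if_pos h]
      rw [e, show n + 1 - (leftCount p.1.1 n + 1) = n - leftCount p.1.1 n by omega,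
        typeCount_urnTypes_succ, addBall_apply]
      ring
    · have e : leftCount p.1.1 (n + 1) = leftCount p.1.1 n := by rw [leftCount, if_neg h]
      simp only [mergedUrn, mergedPick, if_neg h]
      rw [e, show n + 1 - leftCount p.1.1 n = n - leftCount p.1.1 n + 1 by omega,
        typeCount_rot_urnTypes_succ, addBall_apply]
      ring

lemma measurable_urnTypes_uncurry {m : ℕ} (j0 : Fin m) (j : Fin m) :
    Measurable fun q : ℕ × (∀ n : ℕ, Fin (n + 1)) => typeCount (urnTypes j0 q.2 q.1) j :=
  measurable_from_prod_countable_right fun n =>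
    (measurable_pi_apply j).comp (measurable_typeCount_urnTypes j0 n)

lemma measurable_rot_urnTypes_uncurry {m : ℕ} (j0 : Fin m) (j : Fin m) :
    Measurable fun q : ℕ × (∀ n : ℕ, Fin (n + 1)) => typeCount (rot ∘ urnTypes j0 q.2 q.1) j :=
  measurable_from_prod_countable_right fun n =>
    (Measurable.of_discrete (f := fun f : Fin (n + 1) → Fin m => typeCount (rot ∘ f) j)).comp
      (measurable_urnTypes j0 n)

lemma measurable_urnTypes_apply {m : ℕ} (j0 : Fin m) (n : ℕ) :
    Measurable fun c : (∀ n : ℕ, Fin (n + 1)) => urnTypes j0 c n (c n) :=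
  (Measurable.of_discrete (f := fun q : (Fin (n + 1) → Fin m) × Fin (n + 1) => q.1 q.2)).comp
    ((measurable_urnTypes j0 n).prodMk (measurable_pi_apply n))

lemma measurable_leftCount_fst (n : ℕ) :
    Measurable fun p : TripleChoices => leftCount p.1.1 n :=
  (measurable_leftCount n).comp (measurable_fst.comp measurable_fst)

lemma measurable_mergedUrn {m : ℕ} (j0 : Fin m) (n : ℕ) : Measurable (mergedUrn j0 n) := by
  cases n with
  | zero =>
    exact (measurable_typeCount_urnTypes j0 0).comp (measurable_snd.comp measurable_fst)
  | succ n =>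
    refine measurable_pi_lambda _ fun i => Measurable.add ?_ ?_
    · exact (measurable_urnTypes_uncurry j0 i).comp
        ((measurable_leftCount_fst n).prodMk (measurable_snd.comp measurable_fst))
    · exact (measurable_rot_urnTypes_uncurry j0 i).comp
        (((Measurable.of_discrete (f := fun l : ℕ => n - l)).comp
          (measurable_leftCount_fst n)).prodMk measurable_snd)

lemma mergedUrn_nonneg {m : ℕ} (j0 : Fin m) (n : ℕ) (p : TripleChoices) (j : Fin m) :
    0 ≤ mergedUrn j0 n p j := by
  cases n with
  | zero => exact typeCount_nonneg _ _
  | succ n => exact add_nonneg (typeCount_nonneg _ _) (typeCount_nonneg _ _)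

lemma mergedUrn_le {m : ℕ} (j0 : Fin m) (n : ℕ) (p : TripleChoices) (j : Fin m) :
    mergedUrn j0 n p j ≤ n + 1 := by
  cases n with
  | zero =>
    simp only [mergedUrn]
    simpa using typeCount_le (urnTypes j0 p.1.2 0) j
  | succ n =>
    have h := leftCount_le p.1.1 n
    refine (add_le_add (typeCount_le _ _) (typeCount_le _ _)).trans ?_
    push_cast [Nat.cast_sub h]
    linarith

lemma mergedUrn_congr {m : ℕ} (j0 : Fin m) (n : ℕ) {d d' c0 c0' c1 c1' : ∀ n : ℕ, Fin (n + 1)}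
    (hd : ∀ l ≤ n, leftCount d l = leftCount d' l)
    (h0 : ∀ l ≤ leftCount d' n, urnTypes j0 c0 l = urnTypes j0 c0' l)
    (h1 : ∀ l ≤ n - leftCount d' n, urnTypes j0 c1 l = urnTypes j0 c1' l) :
    ∀ l ≤ n + 1, mergedUrn j0 l ((d, c0), c1) = mergedUrn j0 l ((d', c0'), c1') := by
  intro l hl
  cases l with
  | zero => rfl
  | succ l =>
    simp only [mergedUrn]
    rw [hd l (by omega), h0 _ (leftCount_mono d' (by omega)),
      h1 _ (sub_leftCount_mono d' (by omega))]

lemma ofReal_typeCount {m N : ℕ} (f : Fin N → Fin m) (j : Fin m) :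
    ENNReal.ofReal (typeCount f j) = ∑ x, if f x = j then 1 else 0 := by
  rw [typeCount, ENNReal.ofReal_sum_of_nonneg fun x _ => by split_ifs <;> norm_num]
  refine Finset.sum_congr rfl fun x _ => ?_
  split_ifs <;> simp

lemma measurable_mergedPick {m : ℕ} (j0 : Fin m) (n : ℕ) : Measurable (mergedPick j0 n) := by
  cases n with
  | zero => exact measurable_const
  | succ n =>
    have hu : Measurable fun q : ℕ × (∀ n : ℕ, Fin (n + 1)) => urnTypes j0 q.2 q.1 (q.2 q.1) :=
      measurable_from_prod_countable_right fun n => measurable_urnTypes_apply j0 n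
    refine Measurable.ite ?_ ?_ ?_
    · refine measurableSet_le ?_ (measurable_leftCount_fst n)
      exact (Measurable.of_discrete (f := fun x : Fin (n + 1 + 1) => (x : ℕ))).comp
        ((measurable_pi_apply (n + 1)).comp (measurable_fst.comp measurable_fst))
    · exact hu.comp ((measurable_leftCount_fst n).prodMk (measurable_snd.comp measurable_fst))
    · exact (Measurable.of_discrete (f := (rot : Fin m → Fin m))).comp
        (hu.comp (((Measurable.of_discrete (f := fun l : ℕ => n - l)).comp
          (measurable_leftCount_fst n)).prodMk measurable_snd))

lemma lintegral_mul_pick_snd {m : ℕ} (j0 j : Fin m) (i : ℕ) {G : TripleChoices → ENNReal}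
    (hG : Measurable G) (hinv : ∀ p x, G ((p.1.1, Function.update p.1.2 i x), p.2) = G p) :
    ∫⁻ p, G p * ((i + 1) • if urnTypes j0 p.1.2 i (p.1.2 i) = j then 1 else 0) ∂tripleLaw =
      ∫⁻ p, G p * ENNReal.ofReal (typeCount (urnTypes j0 p.1.2 i) j) ∂tripleLaw := by
  have hm : Measurable fun p : TripleChoices =>
      ((i + 1) • if urnTypes j0 p.1.2 i (p.1.2 i) = j then 1 else 0 : ENNReal) :=
    (Measurable.of_discrete
      (f := fun y : Fin m => ((i + 1) • if y = j then 1 else 0 : ENNReal))).comp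
      ((measurable_urnTypes_apply j0 i).comp (measurable_snd.comp measurable_fst))
  refine (lintegral_tripleLaw_update_snd i (hG.mul hm)).trans ?_
  refine lintegral_congr fun p => ?_
  simp only [Pi.mul_apply, hinv, urnTypes_update j0 _ le_rfl, Function.update_self]
  rw [← Finset.mul_sum, ← Finset.smul_sum, ofReal_typeCount, mul_left_comm, nsmul_eq_mul]
  push_cast
  rw [← mul_assoc _ _ (∑ x, _), ENNReal.inv_mul_cancel (by simp) (by finiteness), one_mul]

lemma lintegral_mul_pick_thd {m : ℕ} (j0 j : Fin m) (i : ℕ) {G : TripleChoices → ENNReal}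
    (hG : Measurable G) (hinv : ∀ p x, G (p.1, Function.update p.2 i x) = G p) :
    ∫⁻ p, G p * ((i + 1) • if rot (urnTypes j0 p.2 i (p.2 i)) = j then 1 else 0) ∂tripleLaw =
      ∫⁻ p, G p * ENNReal.ofReal (typeCount (rot ∘ urnTypes j0 p.2 i) j) ∂tripleLaw := by
  have hm : Measurable fun p : TripleChoices =>
      ((i + 1) • if rot (urnTypes j0 p.2 i (p.2 i)) = j then 1 else 0 : ENNReal) :=
    (Measurable.of_discrete
      (f := fun y : Fin m => ((i + 1) • if rot y = j then 1 else 0 : ENNReal))).comp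
      ((measurable_urnTypes_apply j0 i).comp measurable_snd)
  refine (lintegral_tripleLaw_update_thd i (hG.mul hm)).trans ?_
  refine lintegral_congr fun p => ?_
  simp only [Pi.mul_apply, hinv, urnTypes_update j0 _ le_rfl, Function.update_self]
  rw [← Finset.mul_sum, ← Finset.smul_sum, ofReal_typeCount, mul_left_comm, nsmul_eq_mul]
  push_cast
  rw [← mul_assoc _ _ (∑ x, _), ENNReal.inv_mul_cancel (by simp) (by finiteness), one_mul]
  rfl

/-- The contribution of the event that `i` draws have been made in the first urn to the transition
probabilities of the merged urn. -/
lemma lintegral_mul_mergedPick_of_leftCount {m : ℕ} (j0 j : Fin m) {n i : ℕ} (hi : i ≤ n)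
    {G : TripleChoices → ENNReal} (hG : Measurable G)
    (hL : ∀ p, leftCount p.1.1 n ≠ i → G p = 0)
    (hd : ∀ p x, G ((Function.update p.1.1 (n + 1) x, p.1.2), p.2) = G p)
    (h0 : ∀ p x, G ((p.1.1, Function.update p.1.2 i x), p.2) = G p)
    (h1 : ∀ p x, G (p.1, Function.update p.2 (n - i) x) = G p) :
    ∫⁻ p, G p * (if mergedPick j0 (n + 1) p = j then 1 else 0) ∂tripleLaw =
      ∫⁻ p, G p * ENNReal.ofReal (mergedUrn j0 (n + 1) p j / ((n + 1 : ℕ) + 1)) ∂tripleLaw := by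
  have hA : Measurable fun p : TripleChoices =>
      (if urnTypes j0 p.1.2 i (p.1.2 i) = j then 1 else 0 : ENNReal) :=
    (Measurable.of_discrete (f := fun y : Fin m => (if y = j then 1 else 0 : ENNReal))).comp
      ((measurable_urnTypes_apply j0 i).comp (measurable_snd.comp measurable_fst))
  have hB : Measurable fun p : TripleChoices =>
      (if rot (urnTypes j0 p.2 (n - i) (p.2 (n - i))) = j then 1 else 0 : ENNReal) :=
    (Measurable.of_discrete (f := fun y : Fin m => (if rot y = j then 1 else 0 : ENNReal))).comp
      ((measurable_urnTypes_apply j0 (n - i)).comp measurable_snd)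
  have hC : MeasurableSet {p : TripleChoices | (p.1.1 (n + 1) : ℕ) ≤ i} :=
    measurableSet_le ((Measurable.of_discrete (f := fun x : Fin (n + 1 + 1) => (x : ℕ))).comp
        ((measurable_pi_apply (n + 1)).comp (measurable_fst.comp measurable_fst)))
      measurable_const
  have hite : Measurable fun p : TripleChoices => (if (p.1.1 (n + 1) : ℕ) ≤ i then
            (if urnTypes j0 p.1.2 i (p.1.2 i) = j then 1 else 0)
          else (if rot (urnTypes j0 p.2 (n - i) (p.2 (n - i))) = j then 1 else 0) : ENNReal) :=
    Measurable.ite hC hA hB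
  calc ∫⁻ p, G p * (if mergedPick j0 (n + 1) p = j then 1 else 0) ∂tripleLaw
      = ∫⁻ p, G p * (if (p.1.1 (n + 1) : ℕ) ≤ i then
            (if urnTypes j0 p.1.2 i (p.1.2 i) = j then 1 else 0)
          else (if rot (urnTypes j0 p.2 (n - i) (p.2 (n - i))) = j then 1 else 0))
          ∂tripleLaw := by
        refine lintegral_congr fun p => ?_
        by_cases hp : leftCount p.1.1 n = i
        · subst hp
          simp only [mergedPick]
          by_cases h : (p.1.1 (n + 1) : ℕ) ≤ leftCount p.1.1 n
          · simp only [if_pos h]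
          · simp only [if_neg h]
        · rw [hL p hp, zero_mul, zero_mul]
    _ = ∫⁻ p, ((n + 1 : ℕ) + 1 : ENNReal)⁻¹ *
          (G p * ((i + 1) • (if urnTypes j0 p.1.2 i (p.1.2 i) = j then 1 else 0)) +
            G p * ((n - i + 1) •
              (if rot (urnTypes j0 p.2 (n - i) (p.2 (n - i))) = j then 1 else 0)))
          ∂tripleLaw := by
        refine (lintegral_tripleLaw_update_fst (n + 1)
          (hG.mul hite)).trans ?_
        refine lintegral_congr fun p => ?_
        simp only [Pi.mul_apply, hd, Function.update_self]
        rw [← Finset.mul_sum, ← mul_add, ← sum_fin_ite_le hi]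
    _ = ∫⁻ p, ((n + 1 : ℕ) + 1 : ENNReal)⁻¹ *
          (G p * ENNReal.ofReal (typeCount (urnTypes j0 p.1.2 i) j) +
            G p * ENNReal.ofReal (typeCount (rot ∘ urnTypes j0 p.2 (n - i)) j)) ∂tripleLaw := by
        have hr : ((n + 1 : ℕ) + 1 : ENNReal)⁻¹ ≠ ⊤ := by simp
        rw [lintegral_const_mul' _ _ hr, lintegral_const_mul' _ _ hr,
          lintegral_add_left (f := fun p : TripleChoices => G p * ((i + 1) •
            (if urnTypes j0 p.1.2 i (p.1.2 i) = j then 1 else 0)))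
            (hG.mul (hA.const_smul (i + 1))), lintegral_mul_pick_snd j0 j i hG h0,
            lintegral_mul_pick_thd j0 j (n - i) hG h1,
          lintegral_add_left]
        exact hG.mul (((measurable_pi_apply j).comp ((measurable_typeCount_urnTypes j0 i).comp
          (measurable_snd.comp measurable_fst))).ennreal_ofReal)
    _ = ∫⁻ p, G p * ENNReal.ofReal (mergedUrn j0 (n + 1) p j / ((n + 1 : ℕ) + 1)) ∂tripleLaw := by
        refine lintegral_congr fun p => ?_
        by_cases hp : leftCount p.1.1 n = i
        · subst hp
          simp only [mergedUrn]
          rw [ENNReal.ofReal_div_of_pos (by positivity),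
            ENNReal.ofReal_add (typeCount_nonneg _ _) (typeCount_nonneg _ _), ← mul_add,
            ENNReal.div_eq_inv_mul, mul_left_comm,
            ENNReal.ofReal_add (by positivity) (by positivity), ENNReal.ofReal_natCast,
            ENNReal.ofReal_one]
        · simp [hL p hp]

/-- The transition probabilities of the merged urn given its past. -/
lemma lintegral_mul_mergedPick {m : ℕ} (j0 j : Fin m) (n : ℕ)
    {G : TripleChoices → ENNReal} (hG : Measurable G)
    (hinv : ∀ p p', (∀ l ≤ n, mergedUrn j0 l p = mergedUrn j0 l p') → G p = G p') :
    ∫⁻ p, G p * (if mergedPick j0 n p = j then 1 else 0) ∂tripleLaw =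
      ∫⁻ p, G p * ENNReal.ofReal (mergedUrn j0 n p j / (n + 1)) ∂tripleLaw := by
  cases n with
  | zero =>
    refine lintegral_congr fun p => ?_
    simp only [mergedPick, mergedUrn, typeCount_urnTypes_zero, @eq_comm _ j0 j]
    split_ifs <;> simp
  | succ n =>
    have hsum : ∀ p, G p = ∑ i ∈ Finset.range (n + 1),
        if leftCount p.1.1 n = i then G p else 0 := fun p => by
      rw [Finset.sum_ite_eq, if_pos (Finset.mem_range.2 (Nat.lt_succ_of_le (leftCount_le _ _)))]
    have hGm : ∀ i, Measurable fun p : TripleChoices => if leftCount p.1.1 n = i then G p else 0 :=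
      fun i => Measurable.ite (measurable_leftCount_fst n (measurableSet_singleton i)) hG
        measurable_const
    have hsplit : ∀ H : TripleChoices → ENNReal, Measurable H → ∫⁻ p, G p * H p ∂tripleLaw =
        ∑ i ∈ Finset.range (n + 1),
          ∫⁻ p, (if leftCount p.1.1 n = i then G p else 0) * H p ∂tripleLaw := by
      intro H hH
      refine Eq.trans (lintegral_congr fun p => ?_)
        (lintegral_finsetSum _ fun i _ => (hGm i).mul hH)
      change G p * H p =
        ∑ i ∈ Finset.range (n + 1), (if leftCount p.1.1 n = i then G p else 0) * H p
      rw [← Finset.sum_mul, ← hsum]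
    rw [hsplit (fun p => if mergedPick j0 (n + 1) p = j then 1 else 0) ((Measurable.of_discrete
        (f := fun y : Fin m => (if y = j then 1 else 0 : ENNReal))).comp
        (measurable_mergedPick j0 (n + 1))),
      hsplit (fun p => ENNReal.ofReal (mergedUrn j0 (n + 1) p j / ((n + 1 : ℕ) + 1)))
        ((((measurable_pi_apply j).comp
        (measurable_mergedUrn j0 (n + 1))).div_const _).ennreal_ofReal)]
    refine Finset.sum_congr rfl fun i hi => ?_
    refine lintegral_mul_mergedPick_of_leftCount j0 j
      (Nat.lt_succ_iff.1 (Finset.mem_range.1 hi)) (hGm i) (fun p hp => if_neg hp) ?_ ?_ ?_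
    · intro p x
      simp only [leftCount_update _ le_rfl]
      rw [hinv _ p (mergedUrn_congr j0 n (fun l hl => leftCount_update _ hl x)
        (fun _ _ => rfl) fun _ _ => rfl)]
    · intro p x
      by_cases h : leftCount p.1.1 n = i
      · simp only [if_pos h]
        exact hinv _ p (mergedUrn_congr j0 n (fun _ _ => rfl)
          (fun l hl => urnTypes_update j0 _ (hl.trans h.le) x) fun _ _ => rfl)
      · simp only [if_neg h]
    · intro p x
      by_cases h : leftCount p.1.1 n = i
      · simp only [if_pos h]
        exact hinv _ p (mergedUrn_congr j0 n (fun _ _ => rfl) (fun _ _ => rfl)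
          fun l hl => urnTypes_update j0 _ (by rw [← h]; exact hl) x)
      · simp only [if_neg h]

lemma urnFilt_le {Ω : Type*} [mΩ : MeasurableSpace Ω] {m : ℕ} {R : ℕ → Ω → Fin m → ℝ}
    (hR : ∀ n, Measurable (R n)) (n : ℕ) : urnFilt m R n ≤ mΩ :=
  iSup₂_le fun i _ => (hR i).comap_le

lemma mem_iff_of_measurableSet_urnFilt {Ω : Type*} [MeasurableSpace Ω] {m : ℕ}
    {R : ℕ → Ω → Fin m → ℝ} {n : ℕ} {E : Set Ω} (hE : MeasurableSet[urnFilt m R n] E) {p p' : Ω}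
    (h : ∀ l ≤ n, R l p = R l p') : p ∈ E ↔ p' ∈ E := by
  have hle : urnFilt m R n ≤
      MeasurableSpace.comap (fun p (l : ℕ) => R (min l n) p) inferInstance := by
    refine iSup₂_le fun i hi => ?_
    have hmin : min i n = i := min_eq_left (Nat.lt_succ_iff.1 (Finset.mem_range.1 hi))
    rintro _ ⟨S, hS, rfl⟩
    refine ⟨(fun g : ℕ → Fin m → ℝ => g i) ⁻¹' S, measurable_pi_apply i hS, ?_⟩
    ext q
    simp [hmin]
  obtain ⟨T, -, rfl⟩ := hle _ hE
  have : (fun l : ℕ => R (min l n) p) = fun l : ℕ => R (min l n) p' :=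
    funext fun l => h _ (min_le_right _ _)
  simp only [Set.mem_preimage, this]

lemma mergedUrn_zero {m : ℕ} (j0 : Fin m) (p : TripleChoices) :
    mergedUrn j0 0 p = fun i => if i = j0 then 1 else 0 := typeCount_urnTypes_zero j0 p.1.2

lemma exists_nat_mergedUrn {m : ℕ} (j0 : Fin m) (n : ℕ) (p : TripleChoices) (i : Fin m) :
    ∃ z : ℕ, mergedUrn j0 n p i = z := by
  cases n with
  | zero => exact exists_nat_typeCount _ _
  | succ n =>
    obtain ⟨a, ha⟩ := exists_nat_typeCount (urnTypes j0 p.1.2 (leftCount p.1.1 n)) i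
    obtain ⟨b, hb⟩ := exists_nat_typeCount (rot ∘ urnTypes j0 p.2 (n - leftCount p.1.1 n)) i
    exact ⟨a + b, by simp only [mergedUrn, ha, hb, Nat.cast_add]⟩

lemma integrable_mergedUrn_div {m : ℕ} (j0 : Fin m) (n : ℕ) (j : Fin m) :
    Integrable (fun p => mergedUrn j0 n p j / (n + 1)) tripleLaw := by
  refine Integrable.of_bound (C := 1)
    (((measurable_pi_apply j).comp (measurable_mergedUrn j0 n)).div_const _).aestronglyMeasurable
    (Eventually.of_forall fun p => ?_)
  have h0 := mergedUrn_nonneg j0 n p j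
  rw [Real.norm_of_nonneg (by positivity), div_le_one (by positivity)]
  exact mergedUrn_le j0 n p j

theorem isCyclicUrn_mergedUrn {m : ℕ} (j0 : Fin m) :
    IsCyclicUrn tripleLaw m j0 (mergedUrn j0) where
  isProb := inferInstance
  meas := measurable_mergedUrn j0
  natVal := exists_nat_mergedUrn j0
  init := mergedUrn_zero j0
  step n j := by
    have hset : {p | mergedUrn j0 (n + 1) p = fun i => mergedUrn j0 n p i +
        if (i : ℕ) = ((j : ℕ) + 1) % m then 1 else 0} = {p | mergedPick j0 n p = j} := by
      ext p
      simp only [Set.mem_ofPred_eq, mergedUrn_succ]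
      exact (addBall_injective (mergedUrn j0 n p)).eq_iff
    have hm : MeasurableSet {p | mergedPick j0 n p = j} :=
      measurable_mergedPick j0 n (measurableSet_singleton j)
    rw [hset]
    have hle := urnFilt_le (measurable_mergedUrn j0) n
    refine (ae_eq_condExp_of_forall_setIntegral_eq hle
      ((integrable_const (1 : ℝ)).indicator hm)
      (fun s _ _ => (integrable_mergedUrn_div j0 n j).integrableOn) ?_ ?_).symm
    · intro s hs _
      have hs' := hle _ hs
      have key := lintegral_mul_mergedPick j0 j n (G := s.indicator 1)
        (measurable_one.indicator hs') fun p p' h => by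
          have hpp := mem_iff_of_measurableSet_urnFilt hs h
          by_cases hp : p ∈ s
          · simp [hp, hpp.1 hp]
          · simp [hp, mt hpp.2 hp]
      rw [integral_eq_lintegral_of_nonneg_ae, integral_eq_lintegral_of_nonneg_ae]
      · congr 1
        rw [← lintegral_indicator hs', ← lintegral_indicator hs']
        calc _ = _ := lintegral_congr fun p => ?_
          _ = _ := key.symm
          _ = _ := lintegral_congr fun p => ?_
        · by_cases hp : p ∈ s <;> simp [hp]
        · by_cases hp : p ∈ s <;> by_cases hq : mergedPick j0 n p = j <;> simp [hp, hq]
      · exact Eventually.of_forall fun p => Set.indicator_nonneg (fun _ _ => zero_le_one) p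
      · exact (measurable_const.indicator hm).aestronglyMeasurable
      · exact Eventually.of_forall fun p =>
          div_nonneg (mergedUrn_nonneg j0 n p j) (by positivity)
      · exact (((measurable_pi_apply j).comp
          (measurable_mergedUrn j0 n)).div_const _).aestronglyMeasurable
    · have hR : Measurable[urnFilt m (mergedUrn j0) n] (mergedUrn j0 n) := by
        refine Measurable.mono (comap_measurable (mergedUrn j0 n)) ?_ le_rfl
        exact le_iSup₂ (f := fun i (_ : i ∈ Finset.range (n + 1)) =>
          MeasurableSpace.comap (mergedUrn j0 i) inferInstance) n (Finset.self_mem_range_succ n)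
      exact (((measurable_pi_apply j).comp hR).div_const _).stronglyMeasurable.aestronglyMeasurable

lemma lintegral_typeCount_succ {m : ℕ} (j0 : Fin m) (n : ℕ) {f : (Fin m → ℝ) → ENNReal}
    (hf : Measurable f) :
    ∫⁻ c, f (typeCount (urnTypes j0 c (n + 1))) ∂choiceLaw =
      ∫⁻ c, ∑ j, f (addBall (typeCount (urnTypes j0 c n)) j) *
        ENNReal.ofReal (typeCount (urnTypes j0 c n) j / (n + 1)) ∂choiceLaw := by
  rw [lintegral_choiceLaw_update n (f := fun c => f (typeCount (urnTypes j0 c (n + 1))))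
    (hf.comp (measurable_typeCount_urnTypes j0 (n + 1)))]
  refine lintegral_congr fun c => ?_
  simp only [typeCount_urnTypes_succ, urnTypes_update j0 c le_rfl, Function.update_self]
  have h1 : ∀ j, ENNReal.ofReal (typeCount (urnTypes j0 c n) j / (n + 1)) =
      ((n : ENNReal) + 1)⁻¹ * ∑ x, if urnTypes j0 c n x = j then 1 else 0 := fun j => by
    rw [ENNReal.ofReal_div_of_pos (by positivity), ofReal_typeCount, ENNReal.div_eq_inv_mul,
      ENNReal.ofReal_add (by positivity) (by positivity), ENNReal.ofReal_natCast,
      ENNReal.ofReal_one]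
  simp_rw [h1, mul_left_comm _ ((n : ENNReal) + 1)⁻¹, ← Finset.mul_sum, Finset.mul_sum]
  rw [Finset.sum_comm]
  refine Finset.sum_congr rfl fun x _ => ?_
  simp

lemma lintegral_mergedUrn_succ {m : ℕ} (j0 : Fin m) (n : ℕ) {f : (Fin m → ℝ) → ENNReal}
    (hf : Measurable f) :
    ∫⁻ p, f (mergedUrn j0 (n + 1) p) ∂tripleLaw =
      ∫⁻ p, ∑ j, f (addBall (mergedUrn j0 n p) j) *
        ENNReal.ofReal (mergedUrn j0 n p j / (n + 1)) ∂tripleLaw := by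
  have hG : ∀ j, Measurable fun p => f (addBall (mergedUrn j0 n p) j) := fun j =>
    hf.comp ((measurable_addBall j).comp (measurable_mergedUrn j0 n))
  have hI : ∀ j, Measurable fun p => (if mergedPick j0 n p = j then 1 else 0 : ENNReal) := fun j =>
    (Measurable.of_discrete (f := fun y : Fin m => (if y = j then 1 else 0 : ENNReal))).comp
      (measurable_mergedPick j0 n)
  calc ∫⁻ p, f (mergedUrn j0 (n + 1) p) ∂tripleLaw
      = ∫⁻ p, ∑ j, f (addBall (mergedUrn j0 n p) j) *
          (if mergedPick j0 n p = j then 1 else 0) ∂tripleLaw :=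
        lintegral_congr fun p => by simp [mergedUrn_succ]
    _ = ∑ j, ∫⁻ p, f (addBall (mergedUrn j0 n p) j) *
          (if mergedPick j0 n p = j then 1 else 0) ∂tripleLaw :=
        lintegral_finsetSum _ fun j _ => (hG j).mul (hI j)
    _ = ∑ j, ∫⁻ p, f (addBall (mergedUrn j0 n p) j) *
          ENNReal.ofReal (mergedUrn j0 n p j / (n + 1)) ∂tripleLaw :=
        Finset.sum_congr rfl fun j _ => lintegral_mul_mergedPick j0 j n (hG j)
          fun p p' h => by rw [h n le_rfl]
    _ = _ := (lintegral_finsetSum _ fun j _ => (hG j).mul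
        (((measurable_pi_apply j).comp
          (measurable_mergedUrn j0 n)).div_const _).ennreal_ofReal).symm

theorem lintegral_mergedUrn_eq {m : ℕ} (j0 : Fin m) (n : ℕ) {f : (Fin m → ℝ) → ENNReal}
    (hf : Measurable f) :
    ∫⁻ p, f (mergedUrn j0 n p) ∂tripleLaw = ∫⁻ c, f (typeCount (urnTypes j0 c n)) ∂choiceLaw := by
  induction n generalizing f with
  | zero => simp [mergedUrn_zero, typeCount_urnTypes_zero]
  | succ n ih =>
    rw [lintegral_mergedUrn_succ j0 n hf, lintegral_typeCount_succ j0 n hf]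
    refine ih (f := fun w => ∑ j, f (addBall w j) * ENNReal.ofReal (w j / (n + 1))) ?_
    refine Finset.measurable_sum _ fun j _ => ?_
    exact (hf.comp (measurable_addBall j)).mul ((measurable_pi_apply j).div_const _).ennreal_ofReal

/-- The merged urn has the same one-dimensional marginals as a cyclic urn. -/
theorem map_mergedUrn {m : ℕ} (j0 : Fin m) (n : ℕ) :
    tripleLaw.map (mergedUrn j0 n) = choiceLaw.map fun c => typeCount (urnTypes j0 c n) := by
  refine Measure.ext_of_lintegral _ fun f hf => ?_
  rw [lintegral_map hf (measurable_mergedUrn j0 n),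
    lintegral_map hf (measurable_typeCount_urnTypes j0 n), lintegral_mergedUrn_eq j0 n hf]

lemma tendsto_atTop_of_tendsto_div {K : ℕ → ℕ} {u : ℝ} (hu : 0 < u)
    (h : Tendsto (fun n : ℕ => ((K n : ℝ) + 1) / (n + 2)) atTop (𝓝 u)) :
    Tendsto K atTop atTop := by
  have h2 : Tendsto (fun n : ℕ => (n : ℝ) + 2) atTop atTop :=
    tendsto_atTop_add_const_right _ _ tendsto_natCast_atTop_atTop
  have h3 := h.pos_mul_atTop hu h2
  refine (tendsto_natCast_atTop_iff (R := ℝ)).1 ?_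
  refine (tendsto_atTop_add_const_right _ (-1) h3).congr fun n => ?_
  have : (n : ℝ) + 2 ≠ 0 := by positivity
  field_simp
  ring

lemma tendsto_gammaRatio_div_gammaRatio {s : ℂ} (hs : 0 < s.re) {K : ℕ → ℕ} {u : ℝ} (hu : 0 < u)
    (h : Tendsto (fun n : ℕ => ((K n : ℝ) + 1) / (n + 2)) atTop (𝓝 u)) :
    Tendsto (fun n => gammaRatio s (n + 1) / gammaRatio s (K n)) atTop (𝓝 ((u : ℂ) ^ s)) := by
  have hK := tendsto_atTop_of_tendsto_div hu h
  have hinv : Tendsto (fun n : ℕ => 1 / ((n : ℝ) + 1)) atTop (𝓝 0) :=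
    tendsto_one_div_add_atTop_nhds_zero_nat
  have hratio : Tendsto (fun n : ℕ => (K n : ℝ) / (n + 1 : ℕ)) atTop (𝓝 u) := by
    have h1 := (h.mul (hinv.const_add 1)).sub hinv
    simp only [add_zero, mul_one, sub_zero] at h1
    refine h1.congr fun n => ?_
    have : (n : ℝ) + 2 ≠ 0 := by positivity
    have : (n : ℝ) + 1 ≠ 0 := by positivity
    push_cast
    field_simp
    ring
  have hpow : Tendsto (fun n : ℕ => (((K n : ℝ) / (n + 1 : ℕ) : ℝ) : ℂ) ^ s) atTop
      (𝓝 ((u : ℂ) ^ s)) :=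
    ((continuousAt_cpow_const (Complex.ofReal_mem_slitPlane.2 hu)).tendsto.comp
      (Complex.continuous_ofReal.continuousAt.tendsto.comp hratio))
  have ha := (tendsto_cpow_mul_gammaRatio hs).comp (tendsto_add_atTop_nat 1)
  have hb := (tendsto_cpow_mul_gammaRatio hs).comp hK
  have hprod := (ha.div hb one_ne_zero).mul hpow
  rw [div_one, one_mul] at hprod
  refine hprod.congr' ?_
  filter_upwards [hK.eventually_ge_atTop 1] with n hn
  have h1 : ((n + 1 : ℕ) : ℂ) ^ s ≠ 0 :=
    norm_pos_iff.1 (Complex.norm_natCast_cpow_pos_of_pos (by omega) s)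
  have h2 : (K n : ℂ) ^ s ≠ 0 :=
    norm_pos_iff.1 (Complex.norm_natCast_cpow_pos_of_pos (by omega) s)
  have h3 := gammaRatio_ne_zero hs (K n)
  simp only [Function.comp_apply, Pi.div_apply]
  rw [Complex.ofReal_div, Complex.div_cpow_ofReal_nonneg (by positivity) (by positivity)]
  simp only [Complex.ofReal_natCast]
  field_simp

lemma integral_mergedUrn {m : ℕ} (j0 : Fin m) (n : ℕ) {E : Type*} [NormedAddCommGroup E]
    [NormedSpace ℝ E] {f : (Fin m → ℝ) → E} (hf : StronglyMeasurable f) :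
    ∫ p, f (mergedUrn j0 n p) ∂tripleLaw = ∫ c, f (typeCount (urnTypes j0 c n)) ∂choiceLaw := by
  rw [← integral_map (measurable_mergedUrn j0 n).aemeasurable hf.aestronglyMeasurable,
    map_mergedUrn, integral_map (measurable_typeCount_urnTypes j0 n).aemeasurable
      hf.aestronglyMeasurable]

lemma ucoef_sub (m k : ℕ) (v w : Fin m → ℝ) :
    ucoef m k (fun t => v t - w t) = ucoef m k v - ucoef m k w := by
  simp [ucoef, mul_sub]

lemma integrable_mergedUrn {m : ℕ} (j0 : Fin m) (n : ℕ) (j : Fin m) :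
    Integrable (fun p => mergedUrn j0 n p j) tripleLaw := by
  refine Integrable.of_bound (C := n + 1)
    ((measurable_pi_apply j).comp (measurable_mergedUrn j0 n)).aestronglyMeasurable
    (Eventually.of_forall fun p => ?_)
  rw [Real.norm_of_nonneg (mergedUrn_nonneg j0 n p j)]
  exact mergedUrn_le j0 n p j

lemma ucoef_expVec_mergedUrn {m : ℕ} (k : ℕ) (j0 : Fin m) (n : ℕ) :
    ucoef m k (expVec tripleLaw (mergedUrn j0 n)) =
      ∫ p, ucoef m k (mergedUrn j0 n p) ∂tripleLaw := by
  simp only [ucoef, expVec]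
  rw [integral_finsetSum _ fun t _ => ((integrable_mergedUrn j0 n t).ofReal).const_mul _]
  refine Finset.sum_congr rfl fun t _ => ?_
  rw [integral_const_mul]
  congr 1
  exact integral_ofReal.symm

lemma mart_mergedUrn {m : ℕ} {k : ℕ} (hs : 0 < (cw m ^ k).re) (j0 : Fin m) {n : ℕ} (hn : n ≠ 0)
    (p : TripleChoices) :
    Mart tripleLaw m k (mergedUrn j0) n p = gammaRatio (cw m ^ k) n * ucoef m k (mergedUrn j0 n p) -
      gammaRatio (cw m ^ k) 0 * (cw m ^ k) ^ (j0 : ℕ) := by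
  rw [Mart, if_neg hn, ← gammaRatio, ucoef_sub, mul_sub, ucoef_expVec_mergedUrn,
    integral_mergedUrn j0 n (measurable_ucoef m k).stronglyMeasurable, ← integral_urnW hs j0 n,
    ← integral_const_mul]
  rfl

/-- Almost sure limits of sequences with equal marginal laws have equal laws. -/
lemma map_eq_map_of_tendsto {α β E : Type*} [MeasurableSpace α] [MeasurableSpace β]
    [PseudoEMetricSpace E] [MeasurableSpace E] [BorelSpace E]
    {μ : Measure α} [IsProbabilityMeasure μ] {ν : Measure β} [IsProbabilityMeasure ν]
    {X : ℕ → α → E} {Y : ℕ → β → E} {x : α → E} {y : β → E}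
    (hX : ∀ n, Measurable (X n)) (hY : ∀ n, Measurable (Y n))
    (hx : Measurable x) (hy : Measurable y) (h : ∀ n, μ.map (X n) = ν.map (Y n))
    (hXx : ∀ᵐ a ∂μ, Tendsto (fun n => X n a) atTop (𝓝 (x a)))
    (hYy : ∀ᵐ b ∂ν, Tendsto (fun n => Y n b) atTop (𝓝 (y b))) : μ.map x = ν.map y := by
  have := Measure.isProbabilityMeasure_map (μ := μ) hx.aemeasurable
  have := Measure.isProbabilityMeasure_map (μ := ν) hy.aemeasurable
  refine ext_of_forall_integral_eq_of_IsFiniteMeasure fun f => ?_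
  have hf : Measurable f := f.continuous.measurable
  rw [integral_map hx.aemeasurable hf.aestronglyMeasurable,
    integral_map hy.aemeasurable hf.aestronglyMeasurable]
  have h1 : Tendsto (fun n => ∫ a, f (X n a) ∂μ) atTop (𝓝 (∫ a, f (x a) ∂μ)) := by
    refine tendsto_integral_of_dominated_convergence (fun _ => ‖f‖)
      (fun n => (hf.comp (hX n)).aestronglyMeasurable) (integrable_const _)
      (fun n => Eventually.of_forall fun a => f.norm_coe_le_norm _) ?_
    filter_upwards [hXx] with a ha using (f.continuous.tendsto _).comp ha
  have h2 : Tendsto (fun n => ∫ b, f (Y n b) ∂ν) atTop (𝓝 (∫ b, f (y b) ∂ν)) := by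
    refine tendsto_integral_of_dominated_convergence (fun _ => ‖f‖)
      (fun n => (hf.comp (hY n)).aestronglyMeasurable) (integrable_const _)
      (fun n => Eventually.of_forall fun a => f.norm_coe_le_norm _) ?_
    filter_upwards [hYy] with a ha using (f.continuous.tendsto _).comp ha
  refine tendsto_nhds_unique h1 (h2.congr fun n => ?_)
  rw [← integral_map (hX n).aemeasurable hf.aestronglyMeasurable, h n,
    integral_map (hY n).aemeasurable hf.aestronglyMeasurable]

lemma indepFun_comp_measurePreserving {α β γ δ : Type*} [MeasurableSpace α] [MeasurableSpace β]
    [MeasurableSpace γ] [MeasurableSpace δ] {μ : Measure α} {ν : Measure β} {φ : α → β}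
    (hφ : MeasurePreserving φ μ ν) {f : β → γ} {g : β → δ} (hf : Measurable f) (hg : Measurable g)
    (h : IndepFun f g ν) : IndepFun (f ∘ φ) (g ∘ φ) μ := by
  rw [indepFun_iff_measure_inter_preimage_eq_mul] at h ⊢
  intro s t hs ht
  rw [Set.preimage_comp, Set.preimage_comp, ← Set.preimage_inter,
    hφ.measure_preimage ((hf hs).inter (hg ht)).nullMeasurableSet,
    hφ.measure_preimage (hf hs).nullMeasurableSet,
    hφ.measure_preimage (hg ht).nullMeasurableSet, h s t hs ht]

lemma measurePreserving_tripleLaw_fst_fst :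
    MeasurePreserving (fun p : TripleChoices => p.1.1) tripleLaw choiceLaw :=
  measurePreserving_fst.comp measurePreserving_fst

lemma measurePreserving_tripleLaw_fst_snd :
    MeasurePreserving (fun p : TripleChoices => p.1.2) tripleLaw choiceLaw :=
  measurePreserving_snd.comp measurePreserving_fst

lemma measurePreserving_tripleLaw_snd :
    MeasurePreserving (fun p : TripleChoices => p.2) tripleLaw choiceLaw :=
  measurePreserving_snd

lemma ae_mem_Ioo_of_map_eq {α : Type*} [MeasurableSpace α] {μ : Measure α} {U : α → ℝ}
    (hU : Measurable U) (h : μ.map U = volume.restrict (Set.Icc (0 : ℝ) 1)) :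
    ∀ᵐ a ∂μ, U a ∈ Set.Ioo (0 : ℝ) 1 := by
  refine ae_of_ae_map (p := fun x => x ∈ Set.Ioo (0 : ℝ) 1) hU.aemeasurable ?_
  rw [h, ← restrict_Ioo_eq_restrict_Icc]
  exact ae_restrict_mem measurableSet_Ioo

lemma tendsto_mergedUrn {m : ℕ} {k : ℕ} (hs : 0 < (cw m ^ k).re) (j0 : Fin m) {p : TripleChoices}
    {u : ℝ} (hu : u ∈ Set.Ioo (0 : ℝ) 1) {w0 w1 : ℂ}
    (hL : Tendsto (fun n : ℕ => ((leftCount p.1.1 n : ℝ) + 1) / (n + 2)) atTop (𝓝 u))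
    (h0 : Tendsto (fun n => urnW k j0 n p.1.2) atTop (𝓝 w0))
    (h1 : Tendsto (fun n => urnW k j0 n p.2) atTop (𝓝 w1)) :
    Tendsto (fun n => gammaRatio (cw m ^ k) (n + 1) * ucoef m k (mergedUrn j0 (n + 1) p)) atTop
      (𝓝 ((u : ℂ) ^ (cw m ^ k) * w0 + cw m ^ k * ((1 : ℂ) - (u : ℂ)) ^ (cw m ^ k) * w1)) := by
  have hR : Tendsto (fun n : ℕ => (((n - leftCount p.1.1 n : ℕ) : ℝ) + 1) / (n + 2)) atTop
      (𝓝 (1 - u)) := by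
    refine (hL.const_sub 1).congr fun n => ?_
    rw [Nat.cast_sub (leftCount_le _ _)]
    have : (n : ℝ) + 2 ≠ 0 := by positivity
    field_simp
    ring
  have hu' : 0 < 1 - u := sub_pos.2 hu.2
  have hA := (tendsto_gammaRatio_div_gammaRatio hs hu.1 hL).mul
    (h0.comp (tendsto_atTop_of_tendsto_div hu.1 hL))
  have hB := ((tendsto_gammaRatio_div_gammaRatio hs hu' hR).mul
    (h1.comp (tendsto_atTop_of_tendsto_div hu' hR))).const_mul (cw m ^ k)
  have hsum := hA.add hB
  rw [Complex.ofReal_sub, Complex.ofReal_one, ← mul_assoc (cw m ^ k)] at hsum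
  refine hsum.congr fun n => ?_
  have hadd : ucoef m k (mergedUrn j0 (n + 1) p) =
      ucoef m k (typeCount (urnTypes j0 p.1.2 (leftCount p.1.1 n))) +
      cw m ^ k * ucoef m k (typeCount (urnTypes j0 p.2 (n - leftCount p.1.1 n))) := by
    rw [← ucoef_typeCount_rot]
    simp [mergedUrn, ucoef, mul_add, Finset.sum_add_distrib]
  have g0 := gammaRatio_ne_zero hs (leftCount p.1.1 n)
  have g1 := gammaRatio_ne_zero hs (n - leftCount p.1.1 n)
  simp only [Function.comp_apply, urnW]
  rw [hadd]
  field_simp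

lemma measurable_gfun (m k : ℕ) : Measurable (gfun m k) := by
  unfold gfun
  fun_prop

theorem stmt14 (m : ℕ) (hm : 2 ≤ m) (k : ℕ) (hk1 : 1 ≤ k) (hk2 : k ≤ m - 1)
    (hl : 1 / 2 < lam m k) :
    ∃ (Ω : Type) (mΩ : MeasurableSpace Ω) (μ : Measure Ω) (R : ℕ → Ω → Fin m → ℝ)
      (Ξ Ξ0 Ξ1 : Ω → ℂ) (U : Ω → ℝ),
      IsCyclicUrn μ m ⟨0, by omega⟩ R ∧
      μ.map U = volume.restrict (Set.Icc (0 : ℝ) 1) ∧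
      (∀ᵐ ω ∂μ, Tendsto (fun n => Mart μ m k R n ω) atTop (𝓝 (Ξ ω))) ∧
      IndepFun U Ξ0 μ ∧
      IndepFun (fun ω => (U ω, Ξ0 ω)) Ξ1 μ ∧
      IdentDistrib Ξ0 Ξ μ μ ∧
      IdentDistrib Ξ1 Ξ μ μ ∧
      (∀ᵐ ω ∂μ, Ξ ω = ((U ω : ℝ) : ℂ) ^ (cw m ^ k) * Ξ0 ω +
        cw m ^ k * ((1 : ℂ) - (U ω : ℂ)) ^ (cw m ^ k) * Ξ1 ω + gfun m k (U ω)) := by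
  have hs' : 1 / 2 < (cw m ^ k).re := by rwa [re_cw_pow]
  have hs : 0 < (cw m ^ k).re := by linarith
  set j0 : Fin m := ⟨0, by omega⟩ with hj0
  obtain ⟨W, hWm, hW⟩ := exists_tendsto_urnW hs' j0
  obtain ⟨V, hVm, hV⟩ := exists_tendsto_leftCount
  set g : ℂ := (Complex.Gamma (1 + cw m ^ k))⁻¹ with hg
  have hg0 : gammaRatio (cw m ^ k) 0 * (cw m ^ k) ^ (j0 : ℕ) = g := by
    rw [gammaRatio_zero, hj0, pow_zero, mul_one]
  have hVmap := map_eq_uniform_of_tendsto_leftCount hVm hV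
  let f : (∀ n : ℕ, Fin (n + 1)) → ℂ := fun c => W c - g
  have hf : Measurable f := hWm.sub_const g
  let ξ : TripleChoices → ℂ := fun p => ((V p.1.1 : ℝ) : ℂ) ^ (cw m ^ k) * f p.1.2 +
    cw m ^ k * ((1 : ℂ) - (V p.1.1 : ℂ)) ^ (cw m ^ k) * f p.2 + gfun m k (V p.1.1)
  have hVm' : Measurable fun p : TripleChoices => V p.1.1 :=
    hVm.comp measurePreserving_tripleLaw_fst_fst.measurable
  have hf0 : Measurable fun p : TripleChoices => f p.1.2 :=
    hf.comp measurePreserving_tripleLaw_fst_snd.measurable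
  have hf1 : Measurable fun p : TripleChoices => f p.2 :=
    hf.comp measurePreserving_tripleLaw_snd.measurable
  have hξ : Measurable ξ := by
    refine ((Measurable.mul ?_ hf0).add (Measurable.mul ?_ hf1)).add
      ((measurable_gfun m k).comp hVm')
    · exact (Complex.measurable_ofReal.comp hVm').pow_const _
    · exact (((Complex.measurable_ofReal.comp hVm').const_sub 1).pow_const _).const_mul _
  have hlim : ∀ᵐ p ∂tripleLaw, Tendsto
      (fun n => gammaRatio (cw m ^ k) (n + 1) * ucoef m k (mergedUrn j0 (n + 1) p) - g) atTop
      (𝓝 (ξ p)) := by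
    filter_upwards [measurePreserving_tripleLaw_fst_fst.quasiMeasurePreserving.ae hV,
      measurePreserving_tripleLaw_fst_fst.quasiMeasurePreserving.ae
        (ae_mem_Ioo_of_map_eq hVm hVmap),
      measurePreserving_tripleLaw_fst_snd.quasiMeasurePreserving.ae hW,
      measurePreserving_tripleLaw_snd.quasiMeasurePreserving.ae hW] with p hp hu h0 h1
    convert (tendsto_mergedUrn hs j0 hu hp h0 h1).sub_const g using 2
    simp only [ξ, f, gfun, ← hg]
    ring
  have hmap : tripleLaw.map ξ = choiceLaw.map f := by
    have hφ : ∀ n, Measurable fun w => gammaRatio (cw m ^ k) (n + 1) * ucoef m k w - g := fun n =>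
      ((measurable_ucoef m k).const_mul _).sub_const g
    refine map_eq_map_of_tendsto
      (X := fun n p => gammaRatio (cw m ^ k) (n + 1) * ucoef m k (mergedUrn j0 (n + 1) p) - g)
      (Y := fun n c => urnW k j0 (n + 1) c - g)
      (fun n => (hφ n).comp (measurable_mergedUrn j0 (n + 1)))
      (fun n => (measurable_urnW k j0 (n + 1)).sub_const g) hξ hf (fun n => ?_) hlim ?_
    · have h := congrArg (Measure.map fun w => gammaRatio (cw m ^ k) (n + 1) * ucoef m k w - g)
        (map_mergedUrn j0 (n + 1))
      rw [Measure.map_map (hφ n) (measurable_mergedUrn j0 (n + 1)),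
        Measure.map_map (hφ n) (measurable_typeCount_urnTypes j0 (n + 1))] at h
      exact h
    · filter_upwards [hW] with c hc
      exact (hc.comp (tendsto_add_atTop_nat 1)).sub_const g
  refine ⟨TripleChoices, inferInstance, tripleLaw, mergedUrn j0, ξ, fun p => f p.1.2,
    fun p => f p.2, fun p => V p.1.1, isCyclicUrn_mergedUrn j0, ?_, ?_, ?_, ?_, ?_, ?_,
    Eventually.of_forall fun p => rfl⟩
  · rw [← hVmap, ← measurePreserving_tripleLaw_fst_fst.map_eq,
      Measure.map_map hVm measurePreserving_tripleLaw_fst_fst.measurable]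
    rfl
  · filter_upwards [hlim] with p hp
    refine (tendsto_add_atTop_iff_nat 1).1 (hp.congr fun n => ?_)
    rw [mart_mergedUrn hs j0 n.succ_ne_zero, hg0]
  · exact indepFun_comp_measurePreserving (μ := tripleLaw) (ν := choiceLaw.prod choiceLaw)
      measurePreserving_fst (hVm.comp measurable_fst) (hf.comp measurable_snd)
      (indepFun_prod hVm hf)
  · exact indepFun_prod (μ := choiceLaw.prod choiceLaw) (ν := choiceLaw)
      ((hVm.comp measurable_fst).prodMk (hf.comp measurable_snd)) hf
  · refine ⟨hf0.aemeasurable, hξ.aemeasurable, ?_⟩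
    rw [hmap, ← measurePreserving_tripleLaw_fst_snd.map_eq,
      Measure.map_map hf measurePreserving_tripleLaw_fst_snd.measurable]
    rfl
  · refine ⟨hf1.aemeasurable, hξ.aemeasurable, ?_⟩
    rw [hmap, ← measurePreserving_tripleLaw_snd.map_eq,
      Measure.map_map hf measurePreserving_tripleLaw_snd.measurable]
    rfl

end
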